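/- arXiv:2508.04083 — 3 statements merged into one kernel-verified Lean document; each statement's English description precedes it below -/
import Mathlib

section
/- Let G be a finite simple graph with independence number 3, let a₁ be the number of vertices of G, a₂ the number of 2-element independent sets, and a₃ the number of 3-element independent sets, and let P(z) = a₁z + a₂z² + a₃z³ as a map ℂ → ℂ. If a₂² < 3·a₁·a₃, then the Julia set J(P) (the frontier of the set of points with bounded forward orbit under P) is totally disconnected. -/
open Metric in
/-- A connected set cannot be covered by fewer than `diam / d` sets of diameter at most `d`. -/
theorem IsPreconnected.dist_le_card_mul {X κ : Type*} [PseudoMetricSpace X] {C : Set X}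
    (hC : IsPreconnected C) (F : Finset κ) (A : κ → Set X) {d : ℝ} (hd : 0 ≤ d)
    (hcover : ∀ z ∈ C, ∃ p ∈ F, z ∈ A p)
    (hA : ∀ p ∈ F, ∀ x ∈ A p, ∀ y ∈ A p, dist x y ≤ d)
    {x y : X} (hx : x ∈ C) (hy : y ∈ C) : dist y x ≤ F.card * d := by
  have hφ : Continuous fun z => dist z x := by fun_prop
  have hIcc : Set.Icc 0 (dist y x) ⊆ (fun z => dist z x) '' C :=
    (hC.image _ hφ.continuousOn).Icc_subset ⟨x, hx, by simp⟩ ⟨y, hy, rfl⟩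
  have hsub : Set.Icc 0 (dist y x) ⊆ ⋃ p ∈ F, (fun z => dist z x) '' A p := by
    intro r hr
    obtain ⟨z, hz, rfl⟩ := hIcc hr
    obtain ⟨p, hp, hzp⟩ := hcover z hz
    exact Set.mem_biUnion hp ⟨z, hzp, rfl⟩
  have hvol : ENNReal.ofReal (dist y x) ≤ ENNReal.ofReal (F.card * d) :=
    calc ENNReal.ofReal (dist y x) = MeasureTheory.volume (Set.Icc 0 (dist y x)) := by
          rw [Real.volume_Icc, sub_zero]
      _ ≤ MeasureTheory.volume (⋃ p ∈ F, (fun z => dist z x) '' A p) :=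
          MeasureTheory.measure_mono hsub
      _ ≤ ∑ p ∈ F, MeasureTheory.volume ((fun z => dist z x) '' A p) :=
          MeasureTheory.measure_biUnion_finset_le _ _
      _ ≤ ∑ p ∈ F, ENNReal.ofReal d := by
          refine Finset.sum_le_sum fun p hp => (Real.volume_le_diam _).trans (ediam_le ?_)
          rintro _ ⟨a, ha, rfl⟩ _ ⟨b, hb, rfl⟩
          rw [edist_dist]
          refine ENNReal.ofReal_le_ofReal ((le_trans ?_ (hA p hp a ha b hb)))
          rw [Real.dist_eq]
          exact abs_dist_sub_le a b x
      _ = ENNReal.ofReal (F.card * d) := by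
          rw [Finset.sum_const, nsmul_eq_mul, ENNReal.ofReal_mul (by positivity),
            ENNReal.ofReal_natCast]
  exact (ENNReal.ofReal_le_ofReal_iff (by positivity)).1 hvol

namespace InverseBranch

/-- The composite of the maps `g i` along a word. -/
def comp {ι : Type*} (g : ι → ℂ → ℂ) : List ι → ℂ → ℂ
  | [] => id
  | i :: l => g i ∘ comp g l

variable {ι : Type*} {U : Set ℂ} {g : ι → ℂ → ℂ}

theorem mapsTo_comp (hgU : ∀ i, Set.MapsTo (g i) U U) (l : List ι) :
    Set.MapsTo (comp g l) U U := by
  induction l with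
  | nil => exact Set.mapsTo_id U
  | cons i l ih => exact (hgU i).comp ih

theorem differentiableOn_comp (hg : ∀ i, DifferentiableOn ℂ (g i) U)
    (hgU : ∀ i, Set.MapsTo (g i) U U) (l : List ι) : DifferentiableOn ℂ (comp g l) U := by
  induction l with
  | nil => exact differentiableOn_id
  | cons i l ih => exact (hg i).comp ih (mapsTo_comp hgU l)

/-- If all maps `g i` send the bounded domain `U` well inside itself, then derivatives of their
composites decay geometrically. The proof stretches `g i` slightly about a point, which is the
contraction property of the Carathéodory metric. -/
theorem norm_deriv_comp_le {R ε η : ℝ} (hU : IsOpen U) (hUR : U ⊆ Metric.ball 0 R)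
    (hg : ∀ i, DifferentiableOn ℂ (g i) U)
    (hε : ∀ i, ∀ w ∈ U, Metric.closedBall (g i w) ε ⊆ U) (hε0 : 0 ≤ ε)
    (hη : 0 < η) (hηR : η * (2 * R) ≤ ε)
    {δ : ℝ} (hδ : 0 < δ) {z : ℂ} (hz : Metric.closedBall z δ ⊆ U) (l : List ι) (f : ℂ → ℂ)
    (hf : DifferentiableOn ℂ f U) (hfR : Set.MapsTo f U (Metric.ball 0 R)) :
    ‖deriv (f ∘ comp g l) z‖ ≤ R / δ * (1 / (1 + η)) ^ l.length := by
  have hgU : ∀ i, Set.MapsTo (g i) U U := fun i w hw =>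
    hε i w hw (Metric.mem_closedBall_self hε0)
  have hzU : z ∈ U := hz (Metric.mem_closedBall_self hδ.le)
  induction l generalizing f with
  | nil =>
    simp only [comp, Function.comp_id, List.length_nil, pow_zero, mul_one]
    refine Complex.norm_deriv_le_of_forall_mem_sphere_norm_le hδ
      (DifferentiableOn.diffContOnCl ?_) fun w hw => ?_
    · rw [closure_ball z hδ.ne']
      exact hf.mono hz
    · have := hfR (hz (Metric.sphere_subset_closedBall hw))
      rw [mem_ball_zero_iff] at this
      exact this.le
  | cons i l ih =>
    set y := comp g l z with hy
    have hyU : y ∈ U := mapsTo_comp hgU l hzU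
    let s : ℂ → ℂ := fun w => g i w + η * (g i w - g i y)
    have hs : DifferentiableOn ℂ s U :=
      (hg i).add (((hg i).sub_const _).const_mul _)
    have hsU : Set.MapsTo s U U := by
      intro w hw
      refine hε i w hw ?_
      have h1 := mem_ball_zero_iff.1 (hUR (hgU i hw))
      have h2 := mem_ball_zero_iff.1 (hUR (hgU i hyU))
      have h3 := norm_sub_le (g i w) (g i y)
      rw [Metric.mem_closedBall, dist_eq_norm, add_sub_cancel_left, norm_mul, Complex.norm_real,
        Real.norm_of_nonneg hη.le]
      exact le_trans (mul_le_mul_of_nonneg_left (by linarith) hη.le) hηR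
    have key := ih (f ∘ s) (hf.comp hs hsU) (hfR.comp hsU)
    have nhds_mem : ∀ {w}, w ∈ U → U ∈ nhds w := fun hw => hU.mem_nhds hw
    have dl : DifferentiableAt ℂ (comp g l) z :=
      (differentiableOn_comp hg hgU l).differentiableAt (nhds_mem hzU)
    have dg : DifferentiableAt ℂ (g i) y := (hg i).differentiableAt (nhds_mem hyU)
    have hsy : s y = g i y := by simp [s]
    have df : HasDerivAt f (deriv f (g i y)) (g i y) :=
      (hf.differentiableAt (nhds_mem (hgU i hyU))).hasDerivAt
    have ds : HasDerivAt s (deriv (g i) y + η * deriv (g i) y) y :=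
      dg.hasDerivAt.add ((dg.hasDerivAt.sub_const _).const_mul _)
    have e1 : deriv ((f ∘ s) ∘ comp g l) z =
        deriv f (g i y) * (deriv (g i) y + η * deriv (g i) y) * deriv (comp g l) z := by
      refine HasDerivAt.deriv (HasDerivAt.comp z ?_ dl.hasDerivAt)
      exact HasDerivAt.comp y (hsy ▸ df) ds
    have e2 : deriv (f ∘ comp g (i :: l)) z =
        deriv f (g i y) * deriv (g i) y * deriv (comp g l) z := by
      have : f ∘ comp g (i :: l) = (f ∘ g i) ∘ comp g l := rfl
      rw [this]
      refine HasDerivAt.deriv (HasDerivAt.comp z ?_ dl.hasDerivAt)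
      exact HasDerivAt.comp y df dg.hasDerivAt
    have e3 : deriv ((f ∘ s) ∘ comp g l) z = ((1 + η : ℝ) : ℂ) * deriv (f ∘ comp g (i :: l)) z := by
      rw [e1, e2]; push_cast; ring
    have h1η : 0 < 1 + η := by linarith
    rw [e3, norm_mul, Complex.norm_real, Real.norm_of_nonneg h1η.le] at key
    rw [List.length_cons, pow_succ, ← mul_assoc, mul_one_div, le_div_iff₀ h1η]
    linarith

variable {K : Set ℂ} {P : ℂ → ℂ}

theorem exists_eqOn_of_isPreconnected [Finite ι] (hg : ∀ i, ContinuousOn (g i) U)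
    (hP : Continuous P) (hK : Set.MapsTo P K K) (hKU : K ⊆ U)
    (hsec : ∀ z ∈ K, ∃ i, g i (P z) = z) (hinj : ∀ w ∈ U, ∀ i j, g i w = g j w → i = j)
    {C : Set ℂ} (hC : IsPreconnected C) (hne : C.Nonempty) (hCK : C ⊆ K) :
    ∃ i, ∀ z ∈ C, g i (P z) = z := by
  obtain ⟨x, hx⟩ := hne
  obtain ⟨i, hi⟩ := hsec x (hCK hx)
  refine ⟨i, ?_⟩
  have : PreconnectedSpace C := isPreconnected_iff_preconnectedSpace.1 hC
  let E : ι → Set C := fun j => {z | g j (P z) = z}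
  have hE : ∀ j, IsClosed (E j) := fun j => by
    refine isClosed_eq ?_ continuous_subtype_val
    exact (hg j).comp_continuous (hP.comp continuous_subtype_val) fun z => hKU (hK (hCK z.2))
  have hcompl : (E i)ᶜ = ⋃ j ∈ {j | j ≠ i}, E j := by
    ext z
    simp only [Set.mem_compl_iff, Set.mem_iUnion]
    constructor
    · intro hz
      obtain ⟨j, hj⟩ := hsec z (hCK z.2)
      exact ⟨j, fun h => hz (h ▸ hj), hj⟩
    · rintro ⟨j, hji, hj⟩ hz
      exact hji (hinj _ (hKU (hK (hCK z.2))) j i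
        ((hj : g j (P z) = z).trans (hz : g i (P z) = z).symm))
  have hopen : IsOpen (E i) := by
    rw [← isClosed_compl_iff, hcompl]
    exact Set.Finite.isClosed_biUnion (Set.toFinite _) fun j _ => hE j
  have huniv : E i = Set.univ := IsClopen.eq_univ ⟨hE i, hopen⟩ ⟨⟨x, hx⟩, hi⟩
  intro z hz
  have : (⟨z, hz⟩ : C) ∈ E i := huniv ▸ Set.mem_univ _
  exact this

theorem exists_comp_eqOn_of_isPreconnected [Finite ι] (hg : ∀ i, ContinuousOn (g i) U)
    (hP : Continuous P) (hK : Set.MapsTo P K K) (hKU : K ⊆ U)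
    (hsec : ∀ z ∈ K, ∃ i, g i (P z) = z) (hinj : ∀ w ∈ U, ∀ i j, g i w = g j w → i = j)
    (n : ℕ) {C : Set ℂ} (hC : IsPreconnected C) (hne : C.Nonempty) (hCK : C ⊆ K) :
    ∃ l : List ι, l.length = n ∧ ∀ z ∈ C, comp g l (P^[n] z) = z := by
  induction n generalizing C with
  | zero => exact ⟨[], rfl, fun z _ => rfl⟩
  | succ n ih =>
    obtain ⟨i, hi⟩ := exists_eqOn_of_isPreconnected hg hP hK hKU hsec hinj hC hne hCK
    obtain ⟨l, hl, hlC⟩ := ih (hC.image P hP.continuousOn) (hne.image P)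
      ((Set.image_mono hCK).trans hK.image_subset)
    refine ⟨i :: l, by simp [hl], fun z hz => ?_⟩
    rw [Function.iterate_succ_apply, comp, Function.comp_apply, hlC _ ⟨z, hz, rfl⟩, hi z hz]

/-- An invariant set on which `P` admits finitely many pairwise distinct inverse branches, all
mapping a bounded domain well inside itself, is totally disconnected. -/
theorem isTotallyDisconnected [Finite ι] {R ε : ℝ} (hU : IsOpen U)
    (hUR : U ⊆ Metric.ball 0 R) (hg : ∀ i, DifferentiableOn ℂ (g i) U) (hε0 : 0 < ε)
    (hε : ∀ i, ∀ w ∈ U, Metric.closedBall (g i w) ε ⊆ U)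
    (hP : Continuous P) (hK : Set.MapsTo P K K) (hKU : K ⊆ U)
    (hsec : ∀ z ∈ K, ∃ i, g i (P z) = z) (hinj : ∀ w ∈ U, ∀ i j, g i w = g j w → i = j) :
    IsTotallyDisconnected K := by
  intro C hCK hC x hx y hy
  have hgU : ∀ i, Set.MapsTo (g i) U U := fun i w hw =>
    hε i w hw (Metric.mem_closedBall_self hε0.le)
  have hR : 0 < R := (norm_nonneg x).trans_lt (mem_ball_zero_iff.1 (hUR (hKU (hCK hx))))
  have hball : ∀ z ∈ K, Metric.closedBall z ε ⊆ U := fun z hz => by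
    obtain ⟨i, hi⟩ := hsec z hz
    exact hi ▸ hε i _ (hKU (hK hz))
  have hε2 : 0 < ε / 2 := half_pos hε0
  have htb : TotallyBounded K :=
    (isCompact_closedBall (0 : ℂ) R).totallyBounded.subset
      ((hKU.trans hUR).trans Metric.ball_subset_closedBall)
  obtain ⟨t, htK, htfin, ht⟩ := Metric.finite_approx_of_totallyBounded htb (ε / 2) hε2
  set η := ε / (2 * R) with hη
  have hη0 : 0 < η := by positivity
  have hηR : η * (2 * R) ≤ ε := by rw [hη]; field_simp; rfl
  have hlip : ∀ l : List ι, ∀ p ∈ t, ∀ a ∈ Metric.ball p (ε / 2), ∀ b ∈ Metric.ball p (ε / 2),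
      dist (comp g l a) (comp g l b) ≤ R / (ε / 2) * (1 / (1 + η)) ^ l.length * ε := by
    intro l p hp a ha b hb
    have hsub : ∀ z ∈ Metric.ball p (ε / 2), Metric.closedBall z (ε / 2) ⊆ U := fun z hz =>
      (Metric.closedBall_subset_closedBall' (by
        have := Metric.mem_ball.1 hz; linarith)).trans (hball p (htK hp))
    have hle := Convex.norm_image_sub_le_of_norm_deriv_le (𝕜 := ℂ) (f := comp g l)
      (C := R / (ε / 2) * (1 / (1 + η)) ^ l.length)
      (fun z hz => (differentiableOn_comp hg hgU l).differentiableAt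
        (hU.mem_nhds (hsub z hz (Metric.mem_closedBall_self hε2.le))))
      (fun z hz => norm_deriv_comp_le hU hUR hg hε hε0.le hη0 hηR hε2 (hsub z hz) l id
        differentiableOn_id fun w hw => hUR hw) (convex_ball p (ε / 2)) hb ha
    rw [dist_eq_norm]
    refine hle.trans (mul_le_mul_of_nonneg_left ?_ (by positivity))
    rw [← dist_eq_norm]
    have h1 := Metric.mem_ball.1 ha
    have h2 := Metric.mem_ball.1 hb
    have h3 := dist_triangle_right a b p
    linarith
  have hdist : ∀ n : ℕ, dist y x ≤
      htfin.toFinset.card * (R / (ε / 2) * (1 / (1 + η)) ^ n * ε) := by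
    intro n
    obtain ⟨l, hl, hlC⟩ :=
      exists_comp_eqOn_of_isPreconnected (fun i => (hg i).continuousOn) hP hK hKU hsec hinj n hC
        ⟨x, hx⟩ hCK
    refine hC.dist_le_card_mul htfin.toFinset (fun p => comp g l '' Metric.ball p (ε / 2))
      (by positivity) (fun z hz => ?_) ?_ hx hy
    · obtain ⟨p, hp, hzp⟩ := Set.mem_iUnion₂.1 (ht (hK.iterate n (hCK hz)))
      exact ⟨p, htfin.mem_toFinset.2 hp, _, hzp, hlC z hz⟩
    · rintro p hp _ ⟨a, ha, rfl⟩ _ ⟨b, hb, rfl⟩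
      exact hl ▸ hlip l p (htfin.mem_toFinset.1 hp) a ha b hb
  have hlim : Filter.Tendsto (fun n : ℕ =>
      htfin.toFinset.card * (R / (ε / 2) * (1 / (1 + η)) ^ n * ε)) Filter.atTop (nhds 0) := by
    have hpow := tendsto_pow_atTop_nhds_zero_of_lt_one (r := 1 / (1 + η)) (by positivity)
      (by rw [div_lt_one (by positivity)]; linarith)
    simpa using ((hpow.const_mul (R / (ε / 2))).mul_const ε).const_mul
      (htfin.toFinset.card : ℝ)
  exact (dist_le_zero.1 (ge_of_tendsto' hlim hdist)).symm

end InverseBranch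

namespace DepressedCubic

/-- A cubic polynomial in depressed form; its critical points are the square roots of `-σ`. -/
noncomputable def cubic (σ D : ℝ) (y : ℂ) : ℂ := y ^ 3 + 3 * σ * y - D

/-- The plane cut along the two horizontal rays running to the left from `-D ± h * I`, which
are the critical values of `cubic σ D` when `h ^ 2 = 4 * σ ^ 3`. -/
def cutPlane (D h : ℝ) : Set ℂ :=
  {w | w + D - h * Complex.I ∈ Complex.slitPlane ∧ w + D + h * Complex.I ∈ Complex.slitPlane}

/-- The square root of `(w + D) ^ 2 + h ^ 2` that is positive for large real `w`. -/
noncomputable def discSqrt (D h : ℝ) (w : ℂ) : ℂ :=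
  (w + D - h * Complex.I) ^ (1 / 2 : ℂ) * (w + D + h * Complex.I) ^ (1 / 2 : ℂ)

/-- The quantity whose cube roots occur in Cardano's formula. -/
noncomputable def resolvent (D h : ℝ) (w : ℂ) : ℂ := (w + D + discSqrt D h w) / 2

/-- Cardano's formula for a root of `cubic σ D y = w`, indexed by the cube roots of unity. -/
noncomputable def cardano (σ D h : ℝ) (ω : ℂ) (w : ℂ) : ℂ :=
  ω * resolvent D h w ^ (1 / 3 : ℂ) - σ / (ω * resolvent D h w ^ (1 / 3 : ℂ))

variable {σ D h : ℝ}

theorem isOpen_cutPlane (D h : ℝ) : IsOpen (cutPlane D h) :=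
  (Complex.isOpen_slitPlane.preimage (f := fun w : ℂ => w + D - h * Complex.I)
    (by fun_prop)).inter
  (Complex.isOpen_slitPlane.preimage (f := fun w : ℂ => w + D + h * Complex.I) (by fun_prop))

theorem discSqrt_sq (D h : ℝ) (w : ℂ) : discSqrt D h w ^ 2 = (w + D) ^ 2 + h ^ 2 := by
  have e : ∀ x : ℂ, (x ^ (1 / 2 : ℂ)) ^ 2 = x := fun x => by simp
  rw [discSqrt, mul_pow, e, e]
  linear_combination (-(h : ℂ) ^ 2) * Complex.I_sq

theorem resolvent_mul (hσ : h ^ 2 = 4 * σ ^ 3) (w : ℂ) :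
    resolvent D h w * (resolvent D h w - (w + D)) = σ ^ 3 := by
  have hc : (h : ℂ) ^ 2 = 4 * (σ : ℂ) ^ 3 := by exact_mod_cast hσ
  rw [resolvent]
  linear_combination (1 / 4 : ℂ) * discSqrt_sq D h w + (1 / 4 : ℂ) * hc

theorem resolvent_ne_zero (hσ0 : 0 < σ) (hσ : h ^ 2 = 4 * σ ^ 3) (w : ℂ) :
    resolvent D h w ≠ 0 := by
  intro h0
  have := resolvent_mul (D := D) hσ w
  rw [h0, zero_mul] at this
  exact pow_ne_zero 3 (Complex.ofReal_ne_zero.2 hσ0.ne') this.symm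

theorem discSqrt_ofReal_sub (hh : 0 < h) (x : ℝ) : 0 < (discSqrt D h (x - D)).re := by
  set a : ℂ := x - h * Complex.I with ha
  have e1 : (x - D : ℂ) + D - h * Complex.I = a := by rw [ha]; ring
  have e2 : (x - D : ℂ) + D + h * Complex.I = (starRingEnd ℂ) a := by
    rw [ha]; simp
  have him : a.im = -h := by simp [ha]
  have harg : a.arg ≠ Real.pi := by
    intro hpi
    have := (Complex.arg_eq_pi_iff.1 hpi).2
    linarith
  have ha0 : a ≠ 0 := by
    intro h0
    rw [h0, Complex.zero_im] at him
    linarith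
  have hconj : (starRingEnd ℂ) (1 / 2 : ℂ) = 1 / 2 := by simp [map_ofNat]
  rw [discSqrt, e1, e2, Complex.conj_cpow _ _ harg, hconj, Complex.mul_conj, Complex.ofReal_re]
  refine Complex.normSq_pos.2 ?_
  rw [Ne, Complex.cpow_eq_zero_iff]
  tauto

theorem resolvent_mem_slitPlane (hh : 0 < h) (hσ0 : 0 < σ) (hσ : h ^ 2 = 4 * σ ^ 3) (w : ℂ) :
    resolvent D h w ∈ Complex.slitPlane := by
  by_contra hcon
  rw [Complex.mem_slitPlane_iff, not_or, not_lt, not_not] at hcon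
  obtain ⟨hre, him⟩ := hcon
  set T := resolvent D h w with hT
  obtain ⟨τ, hτ⟩ : ∃ τ : ℝ, T = τ := ⟨T.re, by apply Complex.ext <;> simp [him]⟩
  have hτ0 : τ < 0 := by
    have h0 : T ≠ 0 := resolvent_ne_zero hσ0 hσ w
    rw [hτ] at h0 hre
    exact lt_of_le_of_ne (by simpa using hre) (by exact_mod_cast h0)
  have hmul : (τ : ℂ) * (τ - (w + D)) = σ ^ 3 := by
    rw [← hτ]; exact resolvent_mul hσ w
  have hτc : (τ : ℂ) ≠ 0 := by exact_mod_cast hτ0.ne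
  have hw : w = ((τ - σ ^ 3 / τ : ℝ) : ℂ) - D := by
    push_cast
    field_simp
    linear_combination -hmul
  have hS : discSqrt D h w = ((τ + σ ^ 3 / τ : ℝ) : ℂ) := by
    have : discSqrt D h w = 2 * T - (w + D) := by rw [hT, resolvent]; ring
    rw [this, hτ, hw]; push_cast; ring
  have hpos := discSqrt_ofReal_sub (D := D) hh (τ - σ ^ 3 / τ)
  rw [← hw, hS, Complex.ofReal_re] at hpos
  have : σ ^ 3 / τ < 0 := div_neg_of_pos_of_neg (by positivity) hτ0
  linarith

theorem resolvent_cpow_pow (D h : ℝ) (w : ℂ) :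
    (resolvent D h w ^ (1 / 3 : ℂ)) ^ 3 = resolvent D h w := by
  simp

theorem resolvent_cpow_ne_zero (hσ0 : 0 < σ) (hσ : h ^ 2 = 4 * σ ^ 3) (w : ℂ) :
    resolvent D h w ^ (1 / 3 : ℂ) ≠ 0 := by
  intro h0
  have := resolvent_cpow_pow D h w
  rw [h0] at this
  exact resolvent_ne_zero hσ0 hσ w (by rw [← this]; simp)

theorem differentiableOn_cardano (hh : 0 < h) (hσ0 : 0 < σ) (hσ : h ^ 2 = 4 * σ ^ 3) {ω : ℂ}
    (hω : ω ≠ 0) : DifferentiableOn ℂ (cardano σ D h ω) (cutPlane D h) := by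
  have hS : DifferentiableOn ℂ (discSqrt D h) (cutPlane D h) :=
    (DifferentiableOn.cpow (by fun_prop) (by fun_prop) fun w hw => hw.1).mul
      (DifferentiableOn.cpow (by fun_prop) (by fun_prop) fun w hw => hw.2)
  have hT : DifferentiableOn ℂ (resolvent D h) (cutPlane D h) := by
    unfold resolvent
    fun_prop
  have hu : DifferentiableOn ℂ (fun w => resolvent D h w ^ (1 / 3 : ℂ)) (cutPlane D h) :=
    hT.cpow (by fun_prop) fun w _ => resolvent_mem_slitPlane hh hσ0 hσ w
  exact (hu.const_mul ω).sub ((differentiableOn_const _).div (hu.const_mul ω)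
    fun w _ => mul_ne_zero hω (resolvent_cpow_ne_zero hσ0 hσ w))

theorem cubic_cardano (hσ0 : 0 < σ) (hσ : h ^ 2 = 4 * σ ^ 3) {ω : ℂ} (hω : ω ^ 3 = 1) (w : ℂ) :
    cubic σ D (cardano σ D h ω w) = w := by
  have hω0 : ω ≠ 0 := by rintro rfl; norm_num at hω
  have hu0 := resolvent_cpow_ne_zero (D := D) hσ0 hσ w
  have hu3 := resolvent_cpow_pow D h w
  have hmul := resolvent_mul (D := D) hσ w
  rw [cubic, cardano]
  set u := resolvent D h w ^ (1 / 3 : ℂ)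
  set T := resolvent D h w
  have hx0 : ω * u ≠ 0 := mul_ne_zero hω0 hu0
  have hx3 : (ω * u) ^ 3 = T := by rw [mul_pow, hω, hu3, one_mul]
  generalize ω * u = x at *
  rw [← hx3] at hmul
  field_simp
  linear_combination hmul

theorem cardano_mem_roots (hσ0 : 0 < σ) (hσ : h ^ 2 = 4 * σ ^ 3) {ω : ℂ}
    (hω : ω ^ 2 + ω + 1 = 0) (z : ℂ) :
    ∃ j : Fin 3, cardano σ D h (ω ^ (j : ℕ)) (cubic σ D z) = z := by
  have hω0 : ω ≠ 0 := by rintro rfl; norm_num at hω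
  have hu0 := resolvent_cpow_ne_zero (D := D) hσ0 hσ (cubic σ D z)
  have hu3 := resolvent_cpow_pow D h (cubic σ D z)
  have hmul := resolvent_mul (D := D) hσ (cubic σ D z)
  have hinv : ω ^ 2 = ω⁻¹ := by
    field_simp
    linear_combination (ω - 1) * hω
  set u := resolvent D h (cubic σ D z) ^ (1 / 3 : ℂ) with hu
  set b : ℂ := σ / u with hb
  have hbu : b * u = σ := div_mul_cancel₀ _ hu0
  have hz : z ^ 3 + 3 * σ * z = u ^ 3 - b ^ 3 := by
    have h3 : u ^ 3 ≠ 0 := pow_ne_zero 3 hu0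
    refine mul_left_cancel₀ h3 ?_
    rw [← hu3, cubic] at hmul
    linear_combination -hmul + (b ^ 2 * u ^ 2 + b * u * σ + σ ^ 2) * hbu
  have hprod : (z - (u - b)) * ((z - (ω * u - ω ^ 2 * b)) * (z - (ω ^ 2 * u - ω * b))) = 0 := by
    have hω3 : ω ^ 3 = 1 := by linear_combination (ω - 1) * hω
    have hω2 : ω ^ 2 = -ω - 1 := by linear_combination hω
    have hexp : (z - (ω * u - ω ^ 2 * b)) * (z - (ω ^ 2 * u - ω * b)) =
        z ^ 2 + z * (u - b) + u ^ 2 + b ^ 2 + u * b := by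
      rw [hω2]
      linear_combination (-u ^ 2 - b ^ 2 - 2 * u * b) * hω
    rw [hexp]
    linear_combination hz + 3 * z * hbu
  rcases mul_eq_zero.1 hprod with h0 | h0
  · refine ⟨0, ?_⟩
    simp only [cardano, ← hu, Fin.val_zero, pow_zero, one_mul, ← hb]
    linear_combination -h0
  · rcases mul_eq_zero.1 h0 with h0 | h0
    · refine ⟨1, ?_⟩
      have : (σ : ℂ) / (ω * u) = ω ^ 2 * b := by rw [hb, hinv]; field_simp
      simp only [cardano, ← hu, Fin.val_one, pow_one, this]
      linear_combination -h0
    · refine ⟨2, ?_⟩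
      have : (σ : ℂ) / (ω ^ 2 * u) = ω * b := by rw [hb, hinv]; field_simp
      simp only [cardano, ← hu, Fin.val_two, this]
      linear_combination -h0

theorem cardano_injective (hσ0 : 0 < σ) (hσ : h ^ 2 = 4 * σ ^ 3) {w : ℂ}
    (hw : w ∈ cutPlane D h) {ω ω' : ℂ} (hω : ω ^ 3 = 1) (hω' : ω' ^ 3 = 1)
    (heq : cardano σ D h ω w = cardano σ D h ω' w) : ω = ω' := by
  have hω0 : ω ≠ 0 := by rintro rfl; norm_num at hω
  have hω0' : ω' ≠ 0 := by rintro rfl; norm_num at hω'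
  have hu0 := resolvent_cpow_ne_zero (D := D) hσ0 hσ w
  have hu3 := resolvent_cpow_pow D h w
  have hmul := resolvent_mul (D := D) hσ w
  rw [cardano, cardano] at heq
  set u := resolvent D h w ^ (1 / 3 : ℂ)
  set T := resolvent D h w
  have hfac : (ω - ω') * (ω * ω' * u ^ 2 + σ) = 0 := by
    field_simp at heq
    linear_combination heq
  rcases mul_eq_zero.1 hfac with h0 | h0
  · exact sub_eq_zero.1 h0
  exfalso
  have hT2 : T ^ 2 = -σ ^ 3 := by
    have h1 : (ω * ω' * u ^ 2) ^ 3 = T ^ 2 := by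
      rw [← hu3]; linear_combination (u ^ 6 * ω' ^ 3) * hω + u ^ 6 * hω'
    rw [← h1, eq_neg_of_add_eq_zero_left h0]; ring
  have hT0 : T ≠ 0 := resolvent_ne_zero hσ0 hσ w
  have hwT : w + D = 2 * T := by
    refine mul_left_cancel₀ hT0 ?_
    linear_combination -hT2 - hmul
  have hc : (h : ℂ) ^ 2 = 4 * (σ : ℂ) ^ 3 := by exact_mod_cast hσ
  have hzero : (w + D - h * Complex.I) * (w + D + h * Complex.I) = 0 := by
    rw [hwT]; linear_combination 4 * hT2 + hc - (h : ℂ) ^ 2 * Complex.I_sq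
  rcases mul_eq_zero.1 hzero with h1 | h1
  · exact Complex.slitPlane_ne_zero hw.1 h1
  · exact Complex.slitPlane_ne_zero hw.2 h1

theorem continuous_cubic (σ D : ℝ) : Continuous (cubic σ D) := by
  unfold cubic
  fun_prop

theorem cubic_conj (y : ℂ) :
    cubic σ D ((starRingEnd ℂ) y) = (starRingEnd ℂ) (cubic σ D y) := by
  simp [cubic, map_ofNat]

theorem mul_norm_le_norm_cubic {R : ℝ} (hσ0 : 0 < σ) (hD : 0 ≤ D) (hR : 0 < R) (hDR : D ≤ R)
    {y : ℂ} (hy : R ≤ ‖y‖) : (R ^ 2 - 3 * σ - 1) * ‖y‖ ≤ ‖cubic σ D y‖ := by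
  have h1 : ‖y ^ 3‖ ≤ ‖cubic σ D y‖ + ‖(D : ℂ)‖ + ‖3 * (σ : ℂ) * y‖ := by
    have : y ^ 3 = cubic σ D y + D - 3 * σ * y := by rw [cubic]; ring
    rw [this]
    exact (norm_sub_le _ _).trans (by gcongr; exact norm_add_le _ _)
  rw [norm_pow, norm_mul, norm_mul, Complex.norm_real, Complex.norm_real, Real.norm_of_nonneg hD,
    Real.norm_of_nonneg hσ0.le, Complex.norm_ofNat] at h1
  have h2 : R ^ 2 * ‖y‖ ≤ ‖y‖ ^ 3 := by
    have : R ^ 2 ≤ ‖y‖ ^ 2 := pow_le_pow_left₀ hR.le hy 2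
    nlinarith [norm_nonneg y]
  linarith

/-- If the points of the two rays to the left of the critical values leave the disc of radius `R`
after one step, and points outside of this disc escape, then the set of points whose
orbit remains in the disc is totally disconnected. -/
theorem isTotallyDisconnected_of_escape {R : ℝ} (hh : 0 < h) (hσ0 : 0 < σ)
    (hσ : h ^ 2 = 4 * σ ^ 3) (hD : 0 ≤ D) (hR : 0 < R) (hRσ : 3 * σ + 2 < R ^ 2) (hDR : D ≤ R)
    (hray : ∀ t : ℝ, 0 ≤ t → R < ‖cubic σ D (-(D + t) + h * Complex.I)‖) :
    IsTotallyDisconnected {y : ℂ | ∀ n : ℕ, ‖(cubic σ D)^[n] y‖ ≤ R} := by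
  set K : Set ℂ := {y : ℂ | ∀ n : ℕ, ‖(cubic σ D)^[n] y‖ ≤ R} with hK
  set U : Set ℂ := Metric.ball 0 R ∩ cutPlane D h with hU
  have hUo : IsOpen U := Metric.isOpen_ball.inter (isOpen_cutPlane D h)
  have hcut : ∀ y : ℂ, ‖cubic σ D y‖ ≤ R → y ∈ cutPlane D h := by
    intro y hy
    by_contra hcon
    have hcase : y + D - h * Complex.I ∉ Complex.slitPlane ∨
        y + D + h * Complex.I ∉ Complex.slitPlane := by
      by_contra! hboth
      exact hcon hboth
    rcases hcase with hc | hc <;>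
      rw [Complex.mem_slitPlane_iff, not_or, not_lt, not_not] at hc <;>
      simp at hc
    · have e : y = -(D + (-(y.re + D) : ℝ)) + h * Complex.I := by
        apply Complex.ext <;> simp; linarith
      have := hray (-(y.re + D)) (by linarith)
      rw [← e] at this
      linarith
    · have e : (starRingEnd ℂ) y = -(D + (-(y.re + D) : ℝ)) + h * Complex.I := by
        apply Complex.ext <;> simp; linarith
      have := hray (-(y.re + D)) (by linarith)
      rw [← e, cubic_conj, Complex.norm_conj] at this
      linarith
  have hpre : ∀ y : ℂ, ‖cubic σ D y‖ ≤ R → y ∈ U := by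
    intro y hy
    refine ⟨mem_ball_zero_iff.2 ?_, hcut y hy⟩
    by_contra! hcon
    have := mul_norm_le_norm_cubic hσ0 hD hR hDR hcon
    nlinarith
  have hcpt : IsCompact (cubic σ D ⁻¹' Metric.closedBall 0 R) := by
    refine (isCompact_closedBall (0 : ℂ) R).of_isClosed_subset
      (Metric.isClosed_closedBall.preimage (continuous_cubic σ D)) fun y hy => ?_
    exact Metric.ball_subset_closedBall (hpre y (mem_closedBall_zero_iff.1 hy)).1
  obtain ⟨ε, hε0, hε⟩ := hcpt.exists_cthickening_subset_open hUo
    fun y hy => hpre y (mem_closedBall_zero_iff.1 hy)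
  have hroot := Complex.isPrimitiveRoot_exp 3 three_ne_zero
  set ω := Complex.exp (2 * Real.pi * Complex.I / (3 : ℕ))
  have hω3 : ω ^ 3 = 1 := hroot.pow_eq_one
  have hω : ω ^ 2 + ω + 1 = 0 := by
    have h1 : ω - 1 ≠ 0 := sub_ne_zero.2 (hroot.ne_one (by norm_num))
    refine mul_left_cancel₀ h1 ?_
    linear_combination hω3
  have hω0 : ω ≠ 0 := by rintro h0; norm_num [h0] at hω
  have hωj : ∀ j : ℕ, (ω ^ j) ^ 3 = 1 := fun j => by rw [← pow_mul, mul_comm, pow_mul, hω3, one_pow]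
  have hKU : K ⊆ U := fun y hy => hpre y (hy 1)
  refine InverseBranch.isTotallyDisconnected (ι := Fin 3) (R := R) (ε := ε) (P := cubic σ D)
    (g := fun j => cardano σ D h (ω ^ (j : ℕ))) hUo Set.inter_subset_left
    (fun j => (differentiableOn_cardano hh hσ0 hσ (pow_ne_zero _ hω0)).mono
      Set.inter_subset_right) hε0 ?_ (continuous_cubic σ D) ?_ hKU
    (fun z _ => cardano_mem_roots hσ0 hσ hω z) ?_
  · intro j w hw
    refine (Metric.closedBall_subset_cthickening ?_ ε).trans hε
    rw [Set.mem_preimage, cubic_cardano hσ0 hσ (hωj j)]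
    exact Metric.ball_subset_closedBall hw.1
  · intro y hy n
    rw [← Function.iterate_succ_apply]
    exact hy (n + 1)
  · intro w hw i j hij
    exact Fin.ext (hroot.pow_inj i.2 j.2 (cardano_injective hσ0 hσ hw.2 (hωj i) (hωj j) hij))

theorem not_isBounded_of_lt {R : ℝ} (hσ0 : 0 < σ) (hD : 0 ≤ D) (hR : 0 < R)
    (hRσ : 3 * σ + 2 < R ^ 2) (hDR : D ≤ R) {y : ℂ} {n : ℕ} (hn : R < ‖(cubic σ D)^[n] y‖) :
    ¬ Bornology.IsBounded (Set.range fun k => (cubic σ D)^[k] y) := by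
  set μ := R ^ 2 - 3 * σ - 1 with hμ
  have hμ1 : 1 < μ := by rw [hμ]; linarith
  have hgrow : ∀ k : ℕ, μ ^ k * R ≤ ‖(cubic σ D)^[k + n] y‖ := by
    intro k
    induction k with
    | zero => simpa using hn.le
    | succ k ih =>
      have hle : R ≤ ‖(cubic σ D)^[k + n] y‖ :=
        le_trans (le_mul_of_one_le_left hR.le (one_le_pow₀ hμ1.le)) ih
      rw [Nat.succ_add, Function.iterate_succ_apply', pow_succ', mul_assoc]
      exact le_trans (mul_le_mul_of_nonneg_left ih (by linarith))
        (mul_norm_le_norm_cubic hσ0 hD hR hDR hle)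
  intro hb
  obtain ⟨M, hM⟩ := hb.exists_norm_le
  obtain ⟨k, hk⟩ := pow_unbounded_of_one_lt (M / R) hμ1
  have h1 := hM _ ⟨k + n, rfl⟩
  have h2 := hgrow k
  rw [div_lt_iff₀ hR] at hk
  simp only at h1
  linarith

set_option maxHeartbeats 2000000 in
/-- The range of parameters that occurs for reduced independence polynomials. -/
theorem exists_escape_radius {A β : ℝ} (hh : 0 < h) (hσ0 : 0 < σ) (hσ : h ^ 2 = 4 * σ ^ 3)
    (hβ : 0 ≤ β) (hA : A = 3 * β ^ 2 + 3 * σ) (hD : D = β * (3 * σ + β ^ 2 - 1))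
    (hcase : A = 4 ∧ 1 / 3 ≤ σ ∨ A = 5 ∨ 6 ≤ A) :
    0 ≤ D ∧ ∃ R : ℝ, 0 < R ∧ 3 * σ + 2 < R ^ 2 ∧ D ≤ R ∧
      ∀ t : ℝ, 0 ≤ t → R < ‖cubic σ D (-(D + t) + h * Complex.I)‖ := by
  have hD0 : 0 ≤ D := by
    rw [hD]
    refine mul_nonneg hβ ?_
    have : 4 ≤ A := by rcases hcase with h | h | h <;> linarith
    nlinarith
  refine ⟨hD0, ?_⟩
  have hq : D ^ 2 = β ^ 2 * (3 * σ + β ^ 2 - 1) ^ 2 := by rw [hD]; ring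
  have hB0 : 0 ≤ β ^ 2 := sq_nonneg β
  have hre : ∀ t : ℝ, (cubic σ D (-(D + t) + h * Complex.I)).re =
      -((D + t) ^ 3 + 3 * (D + t) * (σ - 4 * σ ^ 3) + D) := by
    intro t
    simp [cubic, pow_succ]
    linear_combination (3 * (D + t)) * hσ
  have him : ∀ t : ℝ, (cubic σ D (-(D + t) + h * Complex.I)).im =
      h * (3 * (D + t) ^ 2 - 4 * σ ^ 3 + 3 * σ) := by
    intro t
    simp [cubic, pow_succ]
    linear_combination (-h) * hσ
  by_cases hbig : 3 * σ + 2 < D ^ 2 + h ^ 2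
  · have hR0 : 0 < D ^ 2 + h ^ 2 := by positivity
    have hsq : √(D ^ 2 + h ^ 2) ^ 2 = D ^ 2 + h ^ 2 := Real.sq_sqrt hR0.le
    have hDR : D ≤ √(D ^ 2 + h ^ 2) := Real.le_sqrt_of_sq_le (by nlinarith)
    refine ⟨√(D ^ 2 + h ^ 2), Real.sqrt_pos.2 hR0, by rw [hsq]; exact hbig, hDR, fun t ht => ?_⟩
    set y : ℂ := -(D + t) + h * Complex.I with hy
    have hyn : √(D ^ 2 + h ^ 2) ≤ ‖y‖ := by
      refine (Real.sqrt_le_left (norm_nonneg y)).2 ?_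
      rw [← Complex.normSq_eq_norm_sq, Complex.normSq_apply, hy]
      simp
      nlinarith
    have hle := mul_norm_le_norm_cubic hσ0 hD0 (Real.sqrt_pos.2 hR0) hDR hyn
    rw [hsq] at hle
    have := Real.sqrt_pos.2 hR0
    nlinarith
  rw [not_lt, hσ] at hbig
  have hB : β ^ 2 = A / 3 - σ := by rw [hA]; ring
  rw [hB] at hq hB0
  have hA6 : A < 6 := by
    by_contra! hA6
    rcases le_or_gt σ 2 with h2 | h2
    · have h3 : (2 - σ) * (1 + 2 * σ) ^ 2 ≤ D ^ 2 := by
        rw [hq]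
        have : (1 + 2 * σ) ^ 2 ≤ (3 * σ + (A / 3 - σ) - 1) ^ 2 :=
          pow_le_pow_left₀ (by linarith) (by linarith) 2
        exact mul_le_mul (by linarith) this (by positivity) hB0
      nlinarith
    · have := sq_nonneg D
      have h4 : 4 ≤ σ ^ 2 := by nlinarith
      nlinarith
  have hsmall : σ ≤ 1 / 2 → 3 * σ + 2 < (D ^ 3 + D) ^ 2 := by
    intro hσ2
    have e : (D ^ 3 + D) ^ 2 = D ^ 2 * (1 + D ^ 2) ^ 2 := by ring
    rw [e]
    rcases hcase with ⟨rfl, h3⟩ | rfl | h6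
    · have h1 : 1 ≤ D ^ 2 := by rw [hq]; nlinarith [mul_nonneg (sub_nonneg.2 h3) (sub_nonneg.2 hσ2)]
      nlinarith
    · have h1 : 20 / 27 + 4 * σ ≤ D ^ 2 := by
        rw [hq]; nlinarith [mul_nonneg (sq_nonneg σ) (sub_nonneg.2 hσ2)]
      have h2 : (47 / 27) ^ 2 ≤ (1 + D ^ 2) ^ 2 := pow_le_pow_left₀ (by norm_num) (by linarith) 2
      nlinarith
    · linarith
  rcases le_or_gt σ (1 / 2) with hσ2 | hσ2
  · have hs := hsmall hσ2
    have hs0 : 0 < √(3 * σ + 2) := Real.sqrt_pos.2 (by linarith)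
    have hssq : √(3 * σ + 2) ^ 2 = 3 * σ + 2 := Real.sq_sqrt (by linarith)
    have hlt : √(3 * σ + 2) < D ^ 3 + D := by
      rw [Real.sqrt_lt' ?_]
      · exact hs
      · have : 0 ≤ D ^ 3 + D := by positivity
        refine lt_of_le_of_ne this fun h0 => ?_
        rw [← h0] at hs
        linarith
    have hDs : D ≤ √(3 * σ + 2) := Real.le_sqrt_of_sq_le (by linarith [pow_pos hσ0 3])
    refine ⟨(√(3 * σ + 2) + (D ^ 3 + D)) / 2, by linarith, by nlinarith, by linarith,
      fun t ht => ?_⟩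
    refine lt_of_lt_of_le ?_ (Complex.abs_re_le_norm _)
    rw [hre, abs_neg]
    refine lt_of_lt_of_le ?_ (le_abs_self _)
    have h1 : 0 ≤ σ - 4 * σ ^ 3 := by nlinarith [mul_nonneg hσ0.le (sub_nonneg.2 hσ2)]
    have h2 : D ^ 3 ≤ (D + t) ^ 3 := pow_le_pow_left₀ hD0 (by linarith) 3
    have h3 : 0 ≤ 3 * (D + t) * (σ - 4 * σ ^ 3) := by positivity
    linarith
  · rcases hcase with ⟨rfl, h3⟩ | rfl | h6
    · have hσ1 : σ < 1 := by
        by_contra! h1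
        rw [hq] at hbig
        nlinarith
      have h4 : 4 ≤ 3 * D ^ 2 - 4 * σ ^ 3 + 3 * σ := by
        rw [hq]
        nlinarith [mul_nonneg (sub_nonneg.2 hσ2.le) (sub_nonneg.2 hσ1.le),
          mul_nonneg hσ0.le (mul_nonneg (sub_nonneg.2 hσ2.le) (sub_nonneg.2 hσ1.le))]
      have h6 : √6 ^ 2 = 6 := Real.sq_sqrt (by norm_num)
      have h60 : 0 < √6 := Real.sqrt_pos.2 (by norm_num)
      have hDle : D ≤ √6 := Real.le_sqrt_of_sq_le (by linarith [pow_pos hσ0 3])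
      refine ⟨√6, h60, by rw [h6]; linarith, hDle, fun t ht => ?_⟩
      refine lt_of_lt_of_le ?_ (Complex.abs_im_le_norm _)
      rw [him]
      refine lt_of_lt_of_le ?_ (le_abs_self _)
      have h5 : 4 ≤ 3 * (D + t) ^ 2 - 4 * σ ^ 3 + 3 * σ := by nlinarith
      have h7 : 1 / 2 ≤ h ^ 2 := by
        have : (1 / 2 : ℝ) ^ 3 ≤ σ ^ 3 := pow_le_pow_left₀ (by norm_num) hσ2.le 3
        rw [hσ]; linarith
      have h8 : √6 < h * 4 := by
        refine (Real.sqrt_lt' (by positivity)).2 ?_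
        nlinarith
      exact h8.trans_le (mul_le_mul_of_nonneg_left h5 hh.le)
    · rw [hq] at hbig
      nlinarith
    · linarith

end DepressedCubic

open DepressedCubic in
/-- A cubic fixing `0` with real coefficients is conjugate to a depressed cubic; if the parameters
are in the escaping range then its Julia set is totally disconnected. -/
theorem isTotallyDisconnected_frontier_of_cubic {n m t : ℝ} (hm : 0 ≤ m) (ht : 0 < t)
    (hcond : m ^ 2 < 3 * n * t)
    (hcase : n = 4 ∧ m ^ 2 ≤ 9 * t ∨ n = 5 ∨ 6 ≤ n)
    {P : ℂ → ℂ} (hP : ∀ z, P z = n * z + m * z ^ 2 + t * z ^ 3) :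
    IsTotallyDisconnected
      (frontier {z : ℂ | Bornology.IsBounded (Set.range fun k => P^[k] z)}) := by
  set r := √t with hr
  have hr0 : 0 < r := Real.sqrt_pos.2 ht
  have hr2 : r ^ 2 = t := Real.sq_sqrt ht.le
  set β := m / (3 * r) with hβ
  have hβm : 3 * r * β = m := by rw [hβ]; field_simp
  have hβ0 : 0 ≤ β := by positivity
  have hβ2 : 9 * t * β ^ 2 = m ^ 2 := by rw [← hβm, ← hr2]; ring
  set σ := n / 3 - β ^ 2 with hσ
  have hσ0 : 0 < σ := by
    by_contra! hcon
    nlinarith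
  set D := β * (3 * σ + β ^ 2 - 1) with hD
  set h := √(4 * σ ^ 3) with hh
  have h2 : h ^ 2 = 4 * σ ^ 3 := Real.sq_sqrt (by positivity)
  have h0 : 0 < h := Real.sqrt_pos.2 (by positivity)
  obtain ⟨hD0, R, hR0, hRσ, hDR, hray⟩ := exists_escape_radius (A := n) h0 hσ0 h2 hβ0
    (by rw [hσ]; ring) hD (by
      rcases hcase with ⟨h4, hmt⟩ | h5 | h6
      · refine Or.inl ⟨h4, ?_⟩
        have : β ^ 2 ≤ 1 := by
          by_contra! hcon
          nlinarith
        rw [hσ, h4]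
        linarith
      · exact Or.inr (Or.inl h5)
      · exact Or.inr (Or.inr h6))
  have htd := isTotallyDisconnected_of_escape h0 hσ0 h2 hD0 hR0 hRσ hDR hray
  let φ : ℂ → ℂ := fun z => r * z + β
  have hφ : Continuous φ := by fun_prop
  have hφinj : Function.Injective φ := fun a b hab =>
    mul_left_cancel₀ (Complex.ofReal_ne_zero.2 hr0.ne') (add_right_cancel hab)
  have hsemi : Function.Semiconj φ P (cubic σ D) := by
    intro z
    have e1 : (r : ℂ) ^ 2 = t := by exact_mod_cast hr2
    have e2 : 3 * (r : ℂ) * β = m := by exact_mod_cast hβm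
    have e3 : (n : ℂ) = 3 * σ + 3 * β ^ 2 := by rw [hσ]; push_cast; ring
    simp only [φ, cubic, hP, hD]
    push_cast
    rw [← e1, ← e2, e3]
    ring
  have hiter : ∀ (k : ℕ) (z : ℂ), φ (P^[k] z) = (cubic σ D)^[k] (φ z) := fun k z =>
    hsemi.iterate_right k z
  set K : Set ℂ := φ ⁻¹' {y : ℂ | ∀ k : ℕ, ‖(cubic σ D)^[k] y‖ ≤ R} with hK
  have hKclosed : IsClosed K := by
    refine IsClosed.preimage hφ ?_
    rw [Set.ofPred_forall]
    exact isClosed_iInter fun k =>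
      isClosed_le ((continuous_cubic σ D).iterate k).norm continuous_const
  have hsub : {z : ℂ | Bornology.IsBounded (Set.range fun k => P^[k] z)} ⊆ K := by
    intro z hz k
    by_contra! hcon
    refine not_isBounded_of_lt hσ0 hD0 hR0 hRσ hDR hcon ?_
    have hz' : Bornology.IsBounded (Set.range fun k => P^[k] z) := hz
    obtain ⟨M, hM⟩ := hz'.exists_norm_le
    refine (isBounded_iff_forall_norm_le).2 ⟨r * M + β, ?_⟩
    rintro _ ⟨j, rfl⟩
    have h1 : ‖P^[j] z‖ ≤ M := hM _ ⟨j, rfl⟩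
    simp only [← hiter, φ]
    refine (norm_add_le _ _).trans ?_
    rw [norm_mul, Complex.norm_real, Complex.norm_real, Real.norm_of_nonneg hr0.le,
      Real.norm_of_nonneg hβ0]
    gcongr
  intro C hC hCpre
  have hCK : C ⊆ K := hC.trans (frontier_subset_closure.trans (hKclosed.closure_subset_iff.2 hsub))
  exact hφinj.subsingleton_image_iff.1
    (htd (φ '' C) (Set.image_subset_iff.2 hCK) (hCpre.image φ hφ.continuousOn))

/-- For a finite simple graph with independence number 3 whose reduced
independence polynomial is `P(z) = a₁z + a₂z² + a₃z³`, if `a₂² < 3·a₁·a₃` then the Julia set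
of `P` (the frontier of the set of points with bounded forward orbit) is totally disconnected. -/
theorem stmt_0 {V : Type*} [Fintype V] [DecidableEq V]
    (G : SimpleGraph V) [DecidableRel G.Adj]
    (a₁ a₂ a₃ : ℕ)
    (ha₁ : a₁ = Fintype.card V)
    (ha₂ : a₂ = (Finset.univ.filter
      (fun s : Finset V => s.card = 2 ∧ ∀ u ∈ s, ∀ v ∈ s, ¬ G.Adj u v)).card)
    (ha₃ : a₃ = (Finset.univ.filter
      (fun s : Finset V => s.card = 3 ∧ ∀ u ∈ s, ∀ v ∈ s, ¬ G.Adj u v)).card)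
    (hindep3 : ∃ s : Finset V, s.card = 3 ∧ ∀ u ∈ s, ∀ v ∈ s, ¬ G.Adj u v)
    (hindep4 : ¬ ∃ s : Finset V, s.card = 4 ∧ ∀ u ∈ s, ∀ v ∈ s, ¬ G.Adj u v)
    (P : ℂ → ℂ)
    (hP : ∀ z, P z = a₁ * z + a₂ * z ^ 2 + a₃ * z ^ 3)
    (hcond : a₂ ^ 2 < 3 * a₁ * a₃) :
    IsTotallyDisconnected
      (frontier {z : ℂ | Bornology.IsBounded (Set.range fun n => P^[n] z)}) := by
  obtain ⟨s, hs3, hs⟩ := hindep3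
  have h1 : 3 ≤ a₁ := by rw [ha₁, ← hs3]; exact s.card_le_univ
  have h2 : 3 ≤ a₂ := by
    have : (s.powersetCard 2).card = 3 := by rw [Finset.card_powersetCard, hs3]; rfl
    rw [ha₂, ← this]
    refine Finset.card_le_card fun p hp => ?_
    obtain ⟨hps, hp2⟩ := Finset.mem_powersetCard.1 hp
    exact Finset.mem_filter.2 ⟨Finset.mem_univ _, hp2, fun u hu v hv => hs u (hps hu) v (hps hv)⟩
  have h3 : a₃ ≤ a₁.choose 3 := by
    rw [ha₃, ha₁, ← Finset.card_univ, ← Finset.card_powersetCard]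
    refine Finset.card_le_card fun p hp => ?_
    exact Finset.mem_powersetCard.2 ⟨Finset.subset_univ _, (Finset.mem_filter.1 hp).2.1⟩
  have h3pos : 0 < a₃ := Nat.pos_of_ne_zero fun h0 => by simp [h0] at hcond
  have hcase : a₁ = 4 ∧ a₂ ^ 2 ≤ 9 * a₃ ∨ a₁ = 5 ∨ 6 ≤ a₁ := by
    by_cases h4 : 4 ≤ a₁
    · by_cases h5 : a₁ = 4
      · refine Or.inl ⟨h5, ?_⟩
        subst h5
        have h34 : a₃ ≤ 4 := h3
        have h26 : a₂ ≤ 6 := by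
          by_contra! hcon
          nlinarith
        interval_cases a₃ <;> interval_cases a₂ <;> omega
      · omega
    · have h31 : a₁ = 3 := by omega
      subst h31
      have h34 : a₃ ≤ 1 := h3
      nlinarith
  exact isTotallyDisconnected_frontier_of_cubic (n := a₁) (m := a₂) (t := a₃) (by positivity)
    (by exact_mod_cast h3pos) (by exact_mod_cast hcond) (by exact_mod_cast hcase)
    fun z => by simpa using hP z
end

section
/- Let G be a finite simple graph with independence number 3, let a₁ be the number of vertices of G, a₂ the number of 2-element independent sets, and a₃ the number of 3-element independent sets, and let P(z) = a₁z + a₂z² + a₃z³ as a map ℂ → ℂ. If a₂² = 3·a₁·a₃ and a₁ > 3, then the Julia set J(P) is totally disconnected. -/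
open Bornology Set

/-- The filled-in Julia set: points with bounded forward orbit. -/
def filledJulia (f : ℂ → ℂ) : Set ℂ := {z | IsBounded (range fun n => f^[n] z)}

theorem mem_filledJulia_iff {f : ℂ → ℂ} {z : ℂ} :
    z ∈ filledJulia f ↔ ∃ C, ∀ n, ‖f^[n] z‖ ≤ C := by
  simp [filledJulia, isBounded_iff_forall_norm_le]

theorem map_mem_filledJulia {f : ℂ → ℂ} {z : ℂ} (hz : z ∈ filledJulia f) :
    f z ∈ filledJulia f := by
  obtain ⟨C, hC⟩ := mem_filledJulia_iff.1 hz
  exact mem_filledJulia_iff.2 ⟨C, fun n => by simpa using hC (n + 1)⟩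

/-- A preconnected set of bounded orbits is a subsingleton if the map expands distances
on every preconnected subset of the filled-in Julia set. -/
theorem subsingleton_of_expanding {f : ℂ → ℂ} (hf : Continuous f) {k : ℝ} (hk : 1 < k)
    (hexp : ∀ C ⊆ filledJulia f, IsPreconnected C →
      ∀ x ∈ C, ∀ y ∈ C, k * ‖x - y‖ ≤ ‖f x - f y‖)
    {C : Set ℂ} (hC : C ⊆ filledJulia f) (hconn : IsPreconnected C) : C.Subsingleton := by
  have key : ∀ n : ℕ, ∀ C ⊆ filledJulia f, IsPreconnected C →
      ∀ x ∈ C, ∀ y ∈ C, k ^ n * ‖x - y‖ ≤ ‖f^[n] x - f^[n] y‖ := by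
    intro n
    induction n with
    | zero => simp
    | succ n ih =>
      intro C hC hconn x hx y hy
      have h := ih (f '' C) (by rintro _ ⟨z, hz, rfl⟩; exact map_mem_filledJulia (hC hz))
        (hconn.image f hf.continuousOn) (f x) (mem_image_of_mem f hx) (f y)
        (mem_image_of_mem f hy)
      rw [Function.iterate_succ_apply, Function.iterate_succ_apply]
      calc k ^ (n + 1) * ‖x - y‖ = k ^ n * (k * ‖x - y‖) := by ring
        _ ≤ k ^ n * ‖f x - f y‖ := by gcongr; exact hexp C hC hconn x hx y hy
        _ ≤ _ := h
  intro x hx y hy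
  by_contra hne
  obtain ⟨A, hA⟩ := mem_filledJulia_iff.1 (hC hx)
  obtain ⟨B, hB⟩ := mem_filledJulia_iff.1 (hC hy)
  have hpos : 0 < ‖x - y‖ := norm_pos_iff.2 (sub_ne_zero.2 hne)
  obtain ⟨n, hn⟩ := pow_unbounded_of_one_lt ((A + B) / ‖x - y‖) hk
  rw [div_lt_iff₀ hpos] at hn
  have h1 := key n C hC hconn x hx y hy
  have h2 := norm_sub_le (f^[n] x) (f^[n] y)
  linarith [hA n, hB n]

theorem half_le_norm_add_of_re_pow_three_nonneg {v : ℂ} {b : ℝ} (hb : 0 < b)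
    (hv : 0 ≤ (v ^ 3).re) : b / 2 ≤ ‖v + b‖ := by
  by_contra! h
  have h2 : ‖v + b‖ ^ 2 < (b / 2) ^ 2 := by gcongr
  rw [← Complex.normSq_eq_norm_sq, Complex.normSq_apply] at h2
  obtain ⟨x, y⟩ := v
  simp only [pow_succ, pow_zero, one_mul, Complex.mul_re, Complex.mul_im, Complex.add_re,
    Complex.add_im, Complex.ofReal_re, Complex.ofReal_im] at h2 hv
  have hx : x < 0 := by nlinarith [sq_nonneg x, sq_nonneg y]
  have hxy : 0 < x ^ 2 - 3 * y ^ 2 := by nlinarith [sq_nonneg (2 * x + 3 * b / 2)]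
  nlinarith [mul_pos_of_neg_of_neg hx (neg_lt_zero.2 hxy)]

/-- The principal cube root. -/
noncomputable def principalCbrt (w : ℂ) : ℂ := Complex.exp (Complex.log w / 3)

theorem principalCbrt_pow_three {w : ℂ} (hw : w ≠ 0) : principalCbrt w ^ 3 = w := by
  rw [principalCbrt, ← Complex.exp_nat_mul]
  push_cast
  rw [mul_div_cancel₀ _ (by norm_num), Complex.exp_log hw]

theorem principalCbrt_mem_sector {w : ℂ} (hw : 0 ≤ w.re) :
    0 ≤ (principalCbrt w).re ∧ 3 * (principalCbrt w).im ^ 2 ≤ (principalCbrt w).re ^ 2 := by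
  have harg := abs_le.1 (Complex.abs_arg_le_pi_div_two_iff.2 hw)
  have him : (Complex.log w / 3).im = w.arg / 3 := by
    rw [show (3 : ℂ) = ((3 : ℝ) : ℂ) by norm_num, Complex.div_ofReal_im, Complex.log_im]
  have hcos : √3 / 2 ≤ Real.cos (w.arg / 3) := by
    rw [← Real.cos_abs, ← Real.cos_pi_div_six]
    have := abs_le.2 (⟨by linarith, by linarith⟩ : -(Real.pi / 6) ≤ w.arg / 3 ∧ w.arg / 3 ≤ _)
    exact Real.cos_le_cos_of_nonneg_of_le_pi (abs_nonneg _) (by linarith [Real.pi_pos]) this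
  have hcos0 : 0 ≤ Real.cos (w.arg / 3) := le_trans (by positivity) hcos
  have hcos2 : 3 / 4 ≤ Real.cos (w.arg / 3) ^ 2 := by
    nlinarith [Real.sq_sqrt (show (0 : ℝ) ≤ 3 by norm_num), Real.sqrt_nonneg 3]
  rw [principalCbrt, Complex.exp_re, Complex.exp_im, him]
  refine ⟨by positivity, ?_⟩
  rw [mul_pow, mul_pow, Real.sin_sq]
  nlinarith [sq_nonneg (Real.exp (Complex.log w / 3).re)]

theorem nine_eighths_le_norm_of_mem_sector {p q : ℂ}
    (hp0 : 0 ≤ p.re) (hp : 3 * p.im ^ 2 ≤ p.re ^ 2) (hpn : 3 / 4 ≤ ‖p‖ ^ 2)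
    (hq0 : 0 ≤ q.re) (hq : 3 * q.im ^ 2 ≤ q.re ^ 2) (hqn : 3 / 4 ≤ ‖q‖ ^ 2) :
    9 / 8 ≤ ‖p ^ 2 + p * q + q ^ 2‖ := by
  rw [← Complex.normSq_eq_norm_sq, Complex.normSq_apply] at hpn hqn
  refine le_trans ?_ (Complex.re_le_norm _)
  obtain ⟨a, b⟩ := p
  obtain ⟨c, d⟩ := q
  simp only [pow_two, Complex.mul_re, Complex.add_re] at *
  have ha : 3 / 4 ≤ a := by nlinarith
  have hc : 3 / 4 ≤ c := by nlinarith
  have hac : 9 / 16 ≤ a * c := by nlinarith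
  have hbd : 3 * (b * d) ≤ a * c := by
    have : (3 * (b * d)) ^ 2 ≤ (a * c) ^ 2 := by
      calc (3 * (b * d)) ^ 2 = (3 * (b * b)) * (3 * (d * d)) := by ring
        _ ≤ (a * a) * (c * c) :=
          mul_le_mul hp hq (mul_nonneg zero_le_three (mul_self_nonneg d)) (mul_self_nonneg a)
        _ = (a * c) ^ 2 := by ring
    exact le_of_sq_le_sq this (by positivity)
  nlinarith

/-- On a connected set of nonzero points whose cubes lie in the right half-plane, cubing
expands distances as soon as the points are not too close to the origin. -/
theorem nine_eighths_mul_norm_sub_le {C : Set ℂ} (hconn : IsPreconnected C)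
    (hre : ∀ z ∈ C, 0 ≤ (z ^ 3).re) (hnorm : ∀ z ∈ C, 3 / 4 ≤ ‖z‖ ^ 2)
    {x y : ℂ} (hx : x ∈ C) (hy : y ∈ C) : 9 / 8 * ‖x - y‖ ≤ ‖x ^ 3 - y ^ 3‖ := by
  have hne : ∀ z ∈ C, z ≠ 0 := by
    rintro z hz rfl
    have := hnorm 0 hz
    norm_num at this
  have hslit : ∀ z ∈ C, z ^ 3 ∈ Complex.slitPlane := by
    intro z hz
    rw [Complex.mem_slitPlane_iff]
    by_contra! h
    exact pow_ne_zero 3 (hne z hz) (Complex.ext (le_antisymm h.1 (hre z hz)) h.2)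
  have hcbrt : ∀ z, principalCbrt z ≠ 0 := fun z => Complex.exp_ne_zero _
  have hcube : ∀ z ∈ C, principalCbrt (z ^ 3) ^ 3 = z ^ 3 := fun z hz =>
    principalCbrt_pow_three (pow_ne_zero 3 (hne z hz))
  have hcont : ContinuousOn (fun z => z / principalCbrt (z ^ 3)) C := by
    refine continuousOn_id.div ?_ fun z _ => hcbrt _
    refine Complex.continuous_exp.comp_continuousOn (ContinuousOn.div_const ?_ _)
    exact (continuous_pow 3).continuousOn.clog hslit
  have hfin : {ζ : ℂ | ζ ^ 3 = 1}.Finite := by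
    refine ((Polynomial.nthRoots 3 (1 : ℂ)).toFinset.finite_toSet).subset fun ζ hζ => ?_
    simpa [Polynomial.mem_nthRoots] using hζ
  have hmaps : MapsTo (fun z => z / principalCbrt (z ^ 3)) C {ζ : ℂ | ζ ^ 3 = 1} := by
    intro z hz
    simp only [mem_ofPred_eq, div_pow, hcube z hz]
    exact div_self (pow_ne_zero 3 (hne z hz))
  have hconst : x / principalCbrt (x ^ 3) = y / principalCbrt (y ^ 3) :=
    hconn.constant_of_mapsTo hfin.isDiscrete hcont hmaps hx hy
  have hunit : ‖x / principalCbrt (x ^ 3)‖ = 1 :=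
    Complex.norm_eq_one_of_pow_eq_one (hmaps hx) (by norm_num)
  set ζ := x / principalCbrt (x ^ 3) with hζ
  have hxe : x = ζ * principalCbrt (x ^ 3) := (div_mul_cancel₀ _ (hcbrt _)).symm
  have hye : y = ζ * principalCbrt (y ^ 3) := by
    rw [hconst]; exact (div_mul_cancel₀ _ (hcbrt _)).symm
  have hpx := principalCbrt_mem_sector (hre x hx)
  have hpy := principalCbrt_mem_sector (hre y hy)
  have hnx : 3 / 4 ≤ ‖principalCbrt (x ^ 3)‖ ^ 2 := by
    have h := hnorm x hx
    rwa [hxe, norm_mul, hunit, one_mul] at h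
  have hny : 3 / 4 ≤ ‖principalCbrt (y ^ 3)‖ ^ 2 := by
    have h := hnorm y hy
    rwa [hye, norm_mul, hunit, one_mul] at h
  have hsec := nine_eighths_le_norm_of_mem_sector hpx.1 hpx.2 hnx hpy.1 hpy.2 hny
  generalize principalCbrt (x ^ 3) = p at *
  generalize principalCbrt (y ^ 3) = q at *
  have hfac : x ^ 3 - y ^ 3 = ζ ^ 2 * (p ^ 2 + p * q + q ^ 2) * (x - y) := by
    rw [hxe, hye]; ring
  rw [hfac, norm_mul, norm_mul, norm_pow, hunit, one_pow, one_mul]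
  gcongr

/-- The unicritical cubic with a fixed point at `s`. -/
def unicriticalCubic (s : ℝ) (u : ℂ) : ℂ := u ^ 3 - ((s ^ 3 - s : ℝ) : ℂ)

theorem continuous_unicriticalCubic (s : ℝ) : Continuous (unicriticalCubic s) := by
  unfold unicriticalCubic; fun_prop

theorem norm_le_of_mem_filledJulia {s : ℝ} (hs : 0 ≤ s) (hs2 : 2 ≤ s ^ 2) {u : ℂ}
    (hu : u ∈ filledJulia (unicriticalCubic s)) : ‖u‖ ≤ s := by
  by_contra! h
  have step : ∀ w : ℂ, s < ‖w‖ → 2 * (‖w‖ - s) ≤ ‖unicriticalCubic s w‖ - s := by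
    intro w hw
    have h1 := norm_sub_norm_le (w ^ 3) ((s ^ 3 - s : ℝ) : ℂ)
    rw [norm_pow, Complex.norm_real, Real.norm_of_nonneg (by nlinarith)] at h1
    have h2 : 2 ≤ ‖w‖ ^ 2 + ‖w‖ * s + s ^ 2 := by nlinarith [norm_nonneg w]
    have h3 := mul_le_mul_of_nonneg_right h2 (sub_nonneg.2 hw.le)
    rw [unicriticalCubic]
    nlinarith
  have key : ∀ n : ℕ, 2 ^ n * (‖u‖ - s) ≤ ‖(unicriticalCubic s)^[n] u‖ - s := by
    intro n
    induction n with
    | zero => simp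
    | succ n ih =>
      rw [Function.iterate_succ_apply']
      have hpos : 0 < 2 ^ n * (‖u‖ - s) := mul_pos (by positivity) (sub_pos.2 h)
      have := step _ (show s < ‖(unicriticalCubic s)^[n] u‖ by linarith)
      rw [pow_succ]
      linarith
  obtain ⟨C, hC⟩ := mem_filledJulia_iff.1 hu
  obtain ⟨n, hn⟩ := pow_unbounded_of_one_lt ((C - s) / (‖u‖ - s)) (one_lt_two (α := ℝ))
  rw [div_lt_iff₀ (sub_pos.2 h)] at hn
  linarith [key n, hC n]

theorem isClosed_filledJulia_unicriticalCubic {s : ℝ} (hs : 0 ≤ s) (hs2 : 2 ≤ s ^ 2) :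
    IsClosed (filledJulia (unicriticalCubic s)) := by
  have : filledJulia (unicriticalCubic s) = ⋂ n, {u | ‖(unicriticalCubic s)^[n] u‖ ≤ s} := by
    ext u
    simp only [mem_iInter, mem_ofPred_eq]
    refine ⟨fun hu n => norm_le_of_mem_filledJulia hs hs2 ?_,
      fun h => mem_filledJulia_iff.2 ⟨s, h⟩⟩
    induction n with
    | zero => exact hu
    | succ n ih => rw [Function.iterate_succ_apply']; exact map_mem_filledJulia ih
  rw [this]
  exact isClosed_iInter fun n =>
    isClosed_le ((continuous_unicriticalCubic s).iterate n).norm continuous_const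

theorem re_pow_three_nonneg_of_mem_filledJulia {s : ℝ} (hs : 0 ≤ s) (hs2 : 2 ≤ s ^ 2) {u : ℂ}
    (hu : u ∈ filledJulia (unicriticalCubic s)) : 0 ≤ (u ^ 3).re := by
  have h1 := norm_le_of_mem_filledJulia hs hs2 (map_mem_filledJulia hu)
  have h2 := (abs_le.1 ((Complex.abs_re_le_norm _).trans h1)).1
  rw [unicriticalCubic, Complex.sub_re, Complex.ofReal_re] at h2
  nlinarith

theorem norm_sq_ge_of_mem_filledJulia {s : ℝ} (hs : 0 ≤ s) (hs2 : 2 ≤ s ^ 2) {u : ℂ}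
    (hu : u ∈ filledJulia (unicriticalCubic s)) : 3 / 4 ≤ ‖u‖ ^ 2 := by
  have hs1 : 1 < s := by nlinarith
  have hb : s ≤ s ^ 3 - s := by nlinarith
  have h := half_le_norm_add_of_re_pow_three_nonneg (b := s ^ 3 - s) (by linarith)
    (re_pow_three_nonneg_of_mem_filledJulia hs hs2 (map_mem_filledJulia hu))
  rw [unicriticalCubic, sub_add_cancel, norm_pow] at h
  by_contra! hlt
  have h6 : (‖u‖ ^ 2) ^ 3 < (3 / 4) ^ 3 := by gcongr
  have h7 : (s / 2) ^ 2 ≤ (‖u‖ ^ 3) ^ 2 := by gcongr; linarith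
  nlinarith

theorem subsingleton_of_isPreconnected_of_subset_filledJulia {s : ℝ} (hs : 0 ≤ s)
    (hs2 : 2 ≤ s ^ 2) {C : Set ℂ} (hC : C ⊆ filledJulia (unicriticalCubic s))
    (hconn : IsPreconnected C) : C.Subsingleton := by
  refine subsingleton_of_expanding (continuous_unicriticalCubic s) (k := 9 / 8) (by norm_num)
    (fun D hD hDconn x hx y hy => ?_) hC hconn
  rw [unicriticalCubic, unicriticalCubic, sub_sub_sub_cancel_right]
  exact nine_eighths_mul_norm_sub_le hDconn
    (fun z hz => re_pow_three_nonneg_of_mem_filledJulia hs hs2 (hD hz))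
    (fun z hz => norm_sq_ge_of_mem_filledJulia hs hs2 (hD hz)) hx hy

/-- The frontier of the filled-in Julia set is totally disconnected for every map that is
affinely conjugate to `unicriticalCubic s` with `2 ≤ s ^ 2`. -/
theorem isTotallyDisconnected_frontier_of_semiconj {s : ℝ} (hs : 0 ≤ s) (hs2 : 2 ≤ s ^ 2)
    {P : ℂ → ℂ} {t c : ℂ} (ht : t ≠ 0)
    (hconj : Function.Semiconj (fun z => t * (z + c)) P (unicriticalCubic s)) :
    IsTotallyDisconnected (frontier (filledJulia P)) := by
  set φ : ℂ → ℂ := fun z => t * (z + c) with hφ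
  have hcont : Continuous φ := by fun_prop
  have hinj : Function.Injective φ := fun x y h => by simpa [hφ, ht] using h
  have hpre : filledJulia P = φ ⁻¹' filledJulia (unicriticalCubic s) := by
    ext z
    have hiter : ∀ n, (unicriticalCubic s)^[n] (φ z) = φ (P^[n] z) := fun n =>
      ((hconj.iterate_right n).eq z).symm
    simp only [mem_preimage, mem_filledJulia_iff, hiter]
    constructor
    · rintro ⟨B, hB⟩
      refine ⟨‖t‖ * (B + ‖c‖), fun n => ?_⟩
      rw [hφ, norm_mul]
      gcongr
      exact (norm_add_le _ _).trans (by gcongr; exact hB n)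
    · rintro ⟨B, hB⟩
      refine ⟨‖t‖⁻¹ * B + ‖c‖, fun n => ?_⟩
      have h : P^[n] z = t⁻¹ * φ (P^[n] z) - c := by
        rw [hφ, inv_mul_cancel_left₀ ht, add_sub_cancel_right]
      rw [h]
      refine (norm_sub_le _ _).trans ?_
      rw [norm_mul, norm_inv]
      gcongr
      exact hB n
  have hclosed : IsClosed (filledJulia P) := by
    rw [hpre]; exact (isClosed_filledJulia_unicriticalCubic hs hs2).preimage hcont
  intro C hC hconn
  refine hinj.subsingleton_image_iff.1 ?_
  refine subsingleton_of_isPreconnected_of_subset_filledJulia hs hs2 ?_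
    (hconn.image φ hcont.continuousOn)
  rw [image_subset_iff, ← hpre]
  exact hC.trans hclosed.frontier_subset

theorem isTotallyDisconnected_frontier_cubic {a₁ a₂ a₃ : ℕ} (h1 : 6 ≤ a₁) (h3 : 0 < a₃)
    (hcond : a₂ ^ 2 = 3 * a₁ * a₃) {P : ℂ → ℂ}
    (hP : ∀ z, P z = a₁ * z + a₂ * z ^ 2 + a₃ * z ^ 3) :
    IsTotallyDisconnected (frontier (filledJulia P)) := by
  have h3' : (0 : ℝ) < a₃ := by exact_mod_cast h3
  have h1' : (6 : ℝ) ≤ a₁ := by exact_mod_cast h1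
  have hc : (a₂ : ℝ) ^ 2 = 3 * a₁ * a₃ := by exact_mod_cast hcond
  obtain ⟨t, ht, hta⟩ : ∃ t : ℝ, 0 < t ∧ t ^ 2 = a₃ :=
    ⟨√a₃, Real.sqrt_pos.2 h3', Real.sq_sqrt h3'.le⟩
  obtain ⟨c, hcn, hc2⟩ : ∃ c : ℝ, 0 ≤ c ∧ (a₂ : ℝ) = 3 * t ^ 2 * c := by
    refine ⟨a₂ / (3 * t ^ 2), by positivity, ?_⟩
    field_simp
  have hc1 : (a₁ : ℝ) = 3 * t ^ 2 * c ^ 2 := by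
    rw [hc2, ← hta] at hc
    have : t ^ 2 * (a₁ - 3 * t ^ 2 * c ^ 2) = 0 := by linarith
    rcases mul_eq_zero.1 this with h | h
    · exact absurd h (by positivity)
    · linarith
  refine isTotallyDisconnected_frontier_of_semiconj (s := t * c) (t := t) (c := c)
    (by positivity) (by nlinarith) (by exact_mod_cast ht.ne') fun z => ?_
  have e1 : (a₁ : ℂ) = 3 * t ^ 2 * c ^ 2 := by exact_mod_cast congrArg Complex.ofReal hc1
  have e2 : (a₂ : ℂ) = 3 * t ^ 2 * c := by exact_mod_cast congrArg Complex.ofReal hc2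
  have e3 : (a₃ : ℂ) = t ^ 2 := by exact_mod_cast congrArg Complex.ofReal hta.symm
  simp only [hP, e1, e2, e3, unicriticalCubic]
  push_cast
  ring

theorem card_independent_pairs_lt {V : Type*} [Fintype V] [DecidableEq V]
    (G : SimpleGraph V) [DecidableRel G.Adj]
    (hindep : ¬ ∃ s : Finset V, s.card = 4 ∧ ∀ u ∈ s, ∀ v ∈ s, ¬ G.Adj u v)
    (hV : 4 ≤ Fintype.card V) :
    (Finset.univ.filter
      (fun s : Finset V => s.card = 2 ∧ ∀ u ∈ s, ∀ v ∈ s, ¬ G.Adj u v)).card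
      < (Fintype.card V).choose 2 := by
  rw [← Finset.card_univ, ← Finset.card_powersetCard]
  refine Finset.card_lt_card ⟨fun s hs => ?_, fun hsub => hindep ?_⟩
  · exact Finset.mem_powersetCard.2 ⟨Finset.subset_univ _, (Finset.mem_filter.1 hs).2.1⟩
  · obtain ⟨s, -, hs⟩ := Finset.exists_subset_card_eq (s := (Finset.univ : Finset V)) (n := 4)
      (by simpa using hV)
    refine ⟨s, hs, fun u _ v _ huv => ?_⟩
    have hmem := hsub (Finset.mem_powersetCard.2
      ⟨Finset.subset_univ {u, v}, Finset.card_pair huv.ne⟩)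
    exact (Finset.mem_filter.1 hmem).2.2 u (by simp) v (by simp) huv

/-- For a finite simple graph with independence number 3 whose reduced
independence polynomial is `P(z) = a₁z + a₂z² + a₃z³`, if `a₂² = 3·a₁·a₃` and `a₁ > 3`
then the Julia set of `P` is totally disconnected. -/
theorem stmt_2 {V : Type*} [Fintype V] [DecidableEq V]
    (G : SimpleGraph V) [DecidableRel G.Adj]
    (a₁ a₂ a₃ : ℕ)
    (ha₁ : a₁ = Fintype.card V)
    (ha₂ : a₂ = (Finset.univ.filter
      (fun s : Finset V => s.card = 2 ∧ ∀ u ∈ s, ∀ v ∈ s, ¬ G.Adj u v)).card)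
    (ha₃ : a₃ = (Finset.univ.filter
      (fun s : Finset V => s.card = 3 ∧ ∀ u ∈ s, ∀ v ∈ s, ¬ G.Adj u v)).card)
    (hindep3 : ∃ s : Finset V, s.card = 3 ∧ ∀ u ∈ s, ∀ v ∈ s, ¬ G.Adj u v)
    (hindep4 : ¬ ∃ s : Finset V, s.card = 4 ∧ ∀ u ∈ s, ∀ v ∈ s, ¬ G.Adj u v)
    (P : ℂ → ℂ)
    (hP : ∀ z, P z = a₁ * z + a₂ * z ^ 2 + a₃ * z ^ 3)
    (hcond : a₂ ^ 2 = 3 * a₁ * a₃) (ha : 3 < a₁) :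
    IsTotallyDisconnected
      (frontier {z : ℂ | Bornology.IsBounded (Set.range fun n => P^[n] z)}) := by
  have h3 : 0 < a₃ := by
    obtain ⟨s, hs⟩ := hindep3
    rw [ha₃]
    exact Finset.card_pos.2 ⟨s, Finset.mem_filter.2 ⟨Finset.mem_univ _, hs⟩⟩
  have hlt : a₂ < a₁.choose 2 := by
    rw [ha₂, ha₁]
    exact card_independent_pairs_lt G hindep4 (by omega)
  have h1 : 6 ≤ a₁ := by
    by_contra! h
    interval_cases a₁
    · have : a₂ < 6 := by simpa [Nat.choose] using hlt
      interval_cases a₂ <;> omega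
    · have : a₂ < 10 := by simpa [Nat.choose] using hlt
      interval_cases a₂ <;> omega
  exact isTotallyDisconnected_frontier_cubic h1 h3 hcond hP
end

section
/- Let G be a finite simple graph with independence number 3, let a₁ be the number of vertices of G, a₂ the number of 2-element independent sets, and a₃ the number of 3-element independent sets, and let P(z) = a₁z + a₂z² + a₃z³ as a map ℂ → ℂ. If 3·a₁·a₃ < a₂² < 4·a₃·(a₁ − 1), then the Julia set J(P) is totally disconnected. -/
open Complex Metric Set
open scoped ComplexConjugate

lemma Complex.sqrt_sq_self (z : ℂ) : z.sqrt ^ 2 = z := by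
  rw [Complex.sqrt, ← Complex.cpow_nat_mul]
  simp

lemma Complex.re_sqrt_pos {z : ℂ} (hz : z ∈ slitPlane) : 0 < z.sqrt.re := by
  rw [Complex.sqrt, Complex.cpow_inv_two_re]
  refine Real.sqrt_pos.2 (half_pos ?_)
  rcases hz with h | h
  · positivity
  · have h₁ := abs_re_lt_norm.2 h
    have h₂ := neg_abs_le z.re
    linarith

lemma Complex.sq_mem_slitPlane {v : ℂ} (hv : 0 < v.re) : v ^ 2 ∈ slitPlane := by
  rw [mem_slitPlane_iff]
  by_cases h : v.im = 0
  · left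
    simp [pow_two, h]
    positivity
  · right
    simp only [pow_two, mul_im]
    intro h'
    have : v.re * v.im = 0 := by linarith
    simp [h, hv.ne'] at this

lemma add_conj_ne_zero {v w : ℂ} (hv : 0 < v.re) (hw : 0 < w.re) : v + conj w ≠ 0 := fun h => by
  have := congrArg Complex.re h
  simp at this
  linarith

/-- On the right half-plane this is the pseudo-hyperbolic distance. -/
noncomputable def halfPlaneDist (v w : ℂ) : ℝ := ‖(v - w) / (v + conj w)‖

lemma halfPlaneDist_lt_one {v w : ℂ} (hv : 0 < v.re) (hw : 0 < w.re) :
    halfPlaneDist v w < 1 := by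
  have hpos : 0 < ‖v + conj w‖ := norm_pos_iff.2 (add_conj_ne_zero hv hw)
  rw [halfPlaneDist, norm_div, div_lt_one hpos]
  refine lt_of_pow_lt_pow_left₀ 2 hpos.le ?_
  rw [← normSq_eq_norm_sq, ← normSq_eq_norm_sq, normSq_apply, normSq_apply]
  simp
  nlinarith [mul_pos hv hw]

lemma re_inverse_cayley_pos {w z : ℂ} (hw : 0 < w.re) (hz : ‖z‖ < 1) :
    0 < ((w + conj w * z) / (1 - z)).re := by
  have hne : 1 - z ≠ 0 := fun h => by
    rw [← sub_eq_zero.1 h] at hz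
    simp at hz
  have hz' : z.re * z.re + z.im * z.im < 1 := by
    rw [← normSq_apply, normSq_eq_norm_sq]
    exact pow_lt_one₀ (norm_nonneg _) hz two_ne_zero
  rw [div_re, ← add_div]
  refine div_pos ?_ (normSq_pos.2 hne)
  simp
  nlinarith [mul_pos hw (sub_pos.2 hz')]

/-- Strict Schwarz–Pick inequality for a non-surjective self-map of the right half-plane. -/
theorem halfPlaneDist_map_lt {h : ℂ → ℂ} (hd : DifferentiableOn ℂ h {v | 0 < v.re})
    (hm : ∀ v : ℂ, 0 < v.re → 0 < (h v).re) {p : ℂ} (hp : 0 < p.re)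
    (hmiss : ∀ v : ℂ, 0 < v.re → h v ≠ p) {v w : ℂ} (hv : 0 < v.re) (hw : 0 < w.re)
    (hne : v ≠ w) : halfPlaneDist (h v) (h w) < halfPlaneDist v w := by
  set e : ℂ → ℂ := fun z => (w + conj w * z) / (1 - z) with he
  set f : ℂ → ℂ := fun z => (h (e z) - h w) / (h (e z) + conj (h w)) with hf
  have hone : ∀ z ∈ ball (0 : ℂ) 1, 1 - z ≠ 0 := fun z hz h => by
    rw [← sub_eq_zero.1 h] at hz
    simp at hz
  have hepos : ∀ z ∈ ball (0 : ℂ) 1, 0 < (e z).re := fun z hz =>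
    re_inverse_cayley_pos hw (mem_ball_zero_iff.1 hz)
  have hed : DifferentiableOn ℂ e (ball 0 1) :=
    DifferentiableOn.div (by fun_prop) (by fun_prop) hone
  have hhe : DifferentiableOn ℂ (fun z => h (e z)) (ball 0 1) := hd.comp hed hepos
  have hfd : DifferentiableOn ℂ f (ball 0 1) :=
    (hhe.sub_const _).div (hhe.add_const _) fun z hz =>
      add_conj_ne_zero (hm _ (hepos z hz)) (hm _ hw)
  have hf0 : f 0 = 0 := by simp [hf, he]
  have hfm : MapsTo f (ball 0 1) (closedBall (f 0) 1) := fun z hz => by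
    rw [hf0, mem_closedBall_zero_iff]
    exact (halfPlaneDist_lt_one (hm _ (hepos z hz)) (hm _ hw)).le
  set z₀ : ℂ := (v - w) / (v + conj w) with hz₀
  have hz₀mem : z₀ ∈ ball (0 : ℂ) 1 := mem_ball_zero_iff.2 (halfPlaneDist_lt_one hv hw)
  have hz₀ne : z₀ ≠ 0 := div_ne_zero (sub_ne_zero.2 hne) (add_conj_ne_zero hv hw)
  have hez₀ : e z₀ = v := by
    have h₁ := add_conj_ne_zero hv hw
    have h₂ := hone z₀ hz₀mem
    rw [he]
    simp only
    rw [div_eq_iff h₂, hz₀]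
    field_simp
    ring
  have hfz₀ : ‖f z₀‖ = halfPlaneDist (h v) (h w) := by
    simp only [hf, hez₀, halfPlaneDist]
  by_contra! hle
  have hle' : ‖z₀‖ ≤ ‖f z₀‖ := by rw [hfz₀]; exact hle
  have hge : ‖f z₀‖ ≤ ‖z₀‖ :=
    norm_le_norm_of_mapsTo_ball hfd (by rwa [hf0] at hfm) hf0 (mem_ball_zero_iff.1 hz₀mem)
  have hslope : ‖dslope f 0 z₀‖ = 1 / 1 := by
    rw [dslope_of_ne _ hz₀ne, slope_def_module, hf0, norm_smul, norm_inv, sub_zero, sub_zero,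
      hge.antisymm hle', inv_mul_cancel₀ (norm_ne_zero_iff.2 hz₀ne), div_one]
  have haff := affine_of_mapsTo_ball_of_norm_dslope_eq_div hfd hfm hz₀mem hslope
  set c := dslope f 0 z₀
  have hc : c ≠ 0 := norm_ne_zero_iff.1 (by rw [hslope]; norm_num)
  set t : ℂ := (p - h w) / (p + conj (h w)) with ht
  have htlt : ‖t‖ < 1 := halfPlaneDist_lt_one hp (hm _ hw)
  have htmem : t / c ∈ ball (0 : ℂ) 1 := by
    rw [mem_ball_zero_iff, norm_div, hslope]
    simpa using htlt
  have hval : f (t / c) = t := by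
    rw [haff htmem, hf0]
    simp [hc]
  have hq := hm _ (hepos _ htmem)
  refine hmiss _ (hepos _ htmem) ?_
  set q := h (e (t / c)) with hqdef
  have heq : (q - h w) / (q + conj (h w)) = (p - h w) / (p + conj (h w)) := hval
  rw [div_eq_div_iff (add_conj_ne_zero hq (hm _ hw)) (add_conj_ne_zero hp (hm _ hw))] at heq
  have hz : (q - p) * (h w + conj (h w)) = 0 := by linear_combination heq
  exact sub_eq_zero.1 ((mul_eq_zero.1 hz).resolve_right (add_conj_ne_zero (hm _ hw) (hm _ hw)))

/-- The three holomorphic inverse branches of the Chebyshev polynomial `4 y ^ 3 - 3 y`, in the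
coordinate `q` for which the slit `(-∞, 1]` becomes `(-∞, 0]`. -/
theorem exists_chebyshev_branches : ∃ Y : Fin 3 → ℂ → ℂ,
    (∀ k, DifferentiableOn ℂ (Y k) slitPlane) ∧ ∀ q ∈ slitPlane,
      (∀ y, 4 * y ^ 3 - 3 * y = 2 * q + 1 ↔ ∃ k, y = Y k q) ∧
        Function.Injective fun k => Y k q := by
  set x : ℂ → ℂ := fun q => 2 * log (q.sqrt + (q + 1).sqrt) / 3 with hx
  obtain ⟨r, hr⟩ : ∃ r : ℂ, r ^ 2 = -3 / 4 := ⟨_, Complex.sqrt_sq_self _⟩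
  have hadd : ∀ q ∈ slitPlane, q + 1 ∈ slitPlane := fun q hq => by
    rcases hq with h | h
    · left; simp; linarith
    · right; simpa using h
  have hpos : ∀ q ∈ slitPlane, 0 < (q.sqrt + (q + 1).sqrt).re := fun q hq => by
    rw [add_re]
    exact add_pos (re_sqrt_pos hq) (re_sqrt_pos (hadd q hq))
  have hxd : DifferentiableOn ℂ x slitPlane := by
    refine DifferentiableOn.div_const (DifferentiableOn.const_mul (DifferentiableOn.clog
      (differentiableOn_sqrt.add (differentiableOn_sqrt.comp (by fun_prop) hadd)) ?_) _) _
    exact fun q hq => Or.inl (hpos q hq)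
  have hcosh : ∀ q ∈ slitPlane, 4 * cosh (x q) ^ 3 - 3 * cosh (x q) = 2 * q + 1 := fun q hq => by
    have h₀ : q.sqrt + (q + 1).sqrt ≠ 0 := fun h => by
      have := hpos q hq
      rw [h] at this
      simp at this
    rw [← cosh_three_mul, hx]
    simp only
    rw [mul_div_cancel₀ _ three_ne_zero, cosh_two_mul, cosh, sinh, exp_neg, exp_log h₀]
    have h₁ := sqrt_sq_self q
    have h₂ := sqrt_sq_self (q + 1)
    have hinv : (q.sqrt + (q + 1).sqrt)⁻¹ = (q + 1).sqrt - q.sqrt := by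
      refine (eq_inv_of_mul_eq_one_left ?_).symm
      linear_combination h₂ - h₁
    rw [hinv]
    linear_combination h₁ + h₂
  refine ⟨![fun q => cosh (x q), fun q => -cosh (x q) / 2 + r * sinh (x q),
    fun q => -cosh (x q) / 2 - r * sinh (x q)], ?_, ?_⟩
  · have hc : DifferentiableOn ℂ (fun q => cosh (x q)) slitPlane := hxd.ccosh
    have hs : DifferentiableOn ℂ (fun q => sinh (x q)) slitPlane := hxd.csinh
    intro k
    fin_cases k
    · exact hc
    · exact (hc.neg.div_const 2).add (hs.const_mul r)
    · exact (hc.neg.div_const 2).sub (hs.const_mul r)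
  · intro q hq
    have h₁ := hcosh q hq
    have h₂ := cosh_sq (x q)
    have hq0 : q ≠ 0 := slitPlane_ne_zero hq
    have hq1 : q + 1 ≠ 0 := slitPlane_ne_zero (hadd q hq)
    set c := cosh (x q) with hc
    set s := sinh (x q) with hs
    constructor
    · intro y
      have key : 4 * y ^ 3 - 3 * y - (2 * q + 1) =
          4 * ((y - c) * ((y - (-c / 2 + r * s)) * (y - (-c / 2 - r * s)))) := by
        linear_combination h₁ + 4 * (y - c) * s ^ 2 * hr + 3 * (y - c) * h₂
      rw [← sub_eq_zero, key]
      simp [Fin.exists_fin_succ, sub_eq_zero, ← hc, ← hs]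
    · have hsq : (2 * q + 1) ^ 2 ≠ 1 := fun h =>
        mul_ne_zero hq0 hq1 (by linear_combination h / 4)
      have hc1 : 4 * c ^ 2 ≠ 1 := fun h => hsq (by
        rw [← h₁]
        linear_combination (4 * c ^ 4 - 5 * c ^ 2 + 1) * h)
      have hs0 : r * s ≠ 0 := by
        refine mul_ne_zero (fun h => by norm_num [h] at hr) fun h => hsq ?_
        rw [h] at h₂
        rw [← h₁]
        linear_combination (16 * c ^ 4 - 8 * c ^ 2 + 1) * h₂
      have h01 : (c - (-c / 2 + r * s)) * (c - (-c / 2 - r * s)) ≠ 0 := fun h => hc1 (by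
        linear_combination 4 / 3 * h + 4 / 3 * s ^ 2 * hr + h₂)
      have h0 := left_ne_zero_of_mul h01
      have h1 := right_ne_zero_of_mul h01
      have h2 : -c / 2 + r * s ≠ -c / 2 - r * s := fun h => hs0 (by linear_combination h / 2)
      rw [sub_ne_zero] at h0 h1
      intro i j hij
      fin_cases i <;> fin_cases j <;>
        simp_all

theorem isCompact_setOf_isBounded_orbit {P : ℂ → ℂ} (hP : Continuous P) {R : ℝ} (hR : 0 < R)
    (hesc : ∀ z, R ≤ ‖z‖ → 2 * ‖z‖ ≤ ‖P z‖) :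
    IsCompact {z : ℂ | Bornology.IsBounded (range fun n => P^[n] z)} := by
  have hgrow : ∀ (n : ℕ) (z : ℂ), R ≤ ‖z‖ → 2 ^ n * R ≤ ‖P^[n] z‖ := by
    intro n
    induction n with
    | zero => intro z hz; simpa using hz
    | succ n ih =>
      intro z hz
      have h₁ := ih z hz
      rw [Function.iterate_succ_apply']
      have h₂ : R ≤ ‖P^[n] z‖ :=
        (le_mul_of_one_le_left hR.le (one_le_pow₀ one_le_two)).trans h₁
      have h₃ := hesc _ h₂
      rw [pow_succ]
      linarith
  have heq : {z : ℂ | Bornology.IsBounded (range fun n => P^[n] z)} =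
      ⋂ n : ℕ, P^[n] ⁻¹' closedBall 0 R := by
    ext z
    simp only [mem_ofPred_eq, mem_iInter, mem_preimage, mem_closedBall_zero_iff]
    constructor
    · intro hb n
      by_contra! hlt
      obtain ⟨M, hM⟩ := isBounded_iff_forall_norm_le.1 hb
      obtain ⟨k, hk⟩ := pow_unbounded_of_one_lt (M / R) one_lt_two
      have h₁ := hgrow k _ hlt.le
      rw [← Function.iterate_add_apply] at h₁
      have h₂ := hM _ (mem_range_self (k + n))
      rw [div_lt_iff₀ hR] at hk
      linarith
    · intro h
      refine isBounded_iff_forall_norm_le.2 ⟨R, ?_⟩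
      rintro _ ⟨n, rfl⟩
      exact h n
  rw [heq]
  refine (isCompact_closedBall (0 : ℂ) R).of_isClosed_subset
    (isClosed_iInter fun n => isClosed_closedBall.preimage (hP.iterate n)) ?_
  exact iInter_subset (fun n : ℕ => P^[n] ⁻¹' closedBall 0 R) 0

lemma halfPlaneDist_nonneg (v w : ℂ) : 0 ≤ halfPlaneDist v w := norm_nonneg _

lemma eq_of_halfPlaneDist_eq_zero {v w : ℂ} (hv : 0 < v.re) (hw : 0 < w.re)
    (h : halfPlaneDist v w = 0) : v = w := by
  rw [halfPlaneDist, norm_eq_zero, div_eq_zero_iff] at h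
  exact sub_eq_zero.1 (h.resolve_right (add_conj_ne_zero hv hw))

/-- A compact forward-invariant subset `K` of the slit plane `ℂ \ (-∞, -ε]` is totally disconnected
if `P` has three holomorphic inverse branches there with pairwise disjoint images, and each of them
is a non-surjective self-map of the slit plane. The square-root coordinate `√(z + ε)` identifies
the slit plane with the right half-plane. -/
theorem isTotallyDisconnected_of_inverse_branches {P : ℂ → ℂ} (hP : Continuous P) {K : Set ℂ}
    (hK : IsCompact K) (hPK : MapsTo P K K) {ε : ℂ} (hKε : ∀ z ∈ K, z + ε ∈ slitPlane)
    {g : Fin 3 → ℂ → ℂ} (hgd : ∀ k, DifferentiableOn ℂ (g k) {v | 0 < v.re})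
    (hg : ∀ v : ℂ, 0 < v.re → ∀ z, P z = v ^ 2 - ε ↔ ∃ k, z = g k v)
    (hginj : ∀ v : ℂ, 0 < v.re → Function.Injective fun k => g k v)
    (hgε : ∀ k, ∀ v : ℂ, 0 < v.re → g k v + ε ∈ slitPlane) {p : ℂ} (hp : 0 < p.re)
    (hmiss : ∀ k, ∀ v : ℂ, 0 < v.re → (g k v + ε).sqrt ≠ p) : IsTotallyDisconnected K := by
  set σ : ℂ → ℂ := fun z => (z + ε).sqrt with hσ
  have hσpos : ∀ z ∈ K, 0 < (σ z).re := fun z hz => re_sqrt_pos (hKε z hz)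
  have hσc : ContinuousOn σ K :=
    continuousOn_sqrt.comp (by fun_prop) hKε
  have hσinj : ∀ z w, σ z = σ w → z = w := fun z w h => by
    have := congrArg (· ^ 2) h
    simpa [hσ, sqrt_sq_self] using this
  set A : Fin 3 → Set ℂ := fun k => {z ∈ K | g k (σ (P z)) = z} with hA
  have hAcl : ∀ k, IsClosed (A k) := fun k => by
    have hc : ContinuousOn (fun z => (g k (σ (P z)), z)) K :=
      ((hgd k).continuousOn.comp (hσc.comp hP.continuousOn hPK)
        fun z hz => hσpos _ (hPK hz)).prodMk continuousOn_id
    exact hc.preimage_isClosed_of_isClosed hK.isClosed isClosed_diagonal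
  have hAcover : ∀ z ∈ K, ∃ k, z ∈ A k := fun z hz => by
    obtain ⟨k, hk⟩ := (hg (σ (P z)) (hσpos _ (hPK hz)) z).1 (by simp [hσ, sqrt_sq_self])
    exact ⟨k, hz, hk.symm⟩
  have hAdisj : ∀ z k j, z ∈ A k → z ∈ A j → k = j := fun z k j hk hj =>
    hginj (σ (P z)) (hσpos _ (hPK hk.1)) (hk.2.trans hj.2.symm)
  have hsheet : ∀ C ⊆ K, IsPreconnected C → ∀ a ∈ C, ∃ k, C ⊆ A k := fun C hCK hC a ha => by
    obtain ⟨k, hk⟩ := hAcover a (hCK ha)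
    refine ⟨k, ?_⟩
    have := isPreconnected_iff_subset_of_disjoint_closed.1 hC (A k) (⋃ j : {j // j ≠ k}, A j)
      (hAcl k) (isClosed_iUnion_of_finite fun j => hAcl j) ?_ ?_
    · refine this.resolve_right fun h => ?_
      obtain ⟨j, hj⟩ := mem_iUnion.1 (h ha)
      exact j.2 (hAdisj a j k hj hk)
    · intro z hz
      obtain ⟨j, hj⟩ := hAcover z (hCK hz)
      by_cases hjk : j = k
      · exact Or.inl (hjk ▸ hj)
      · exact Or.inr (mem_iUnion.2 ⟨⟨j, hjk⟩, hj⟩)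
    · refine eq_empty_of_forall_notMem fun z hz => ?_
      obtain ⟨j, hj⟩ := mem_iUnion.1 hz.2.2
      exact j.2 (hAdisj z j k hj hz.2.1)
  set S : Set (ℂ × ℂ) := {x | ∃ C ⊆ K, IsPreconnected C ∧ x.1 ∈ C ∧ x.2 ∈ C} with hS
  have hSA : closure S ⊆ ⋃ k, A k ×ˢ A k := by
    refine closure_minimal ?_ (isClosed_iUnion_of_finite fun k => (hAcl k).prod (hAcl k))
    rintro x ⟨C, hCK, hC, h₁, h₂⟩
    obtain ⟨k, hk⟩ := hsheet C hCK hC _ h₁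
    exact mem_iUnion.2 ⟨k, hk h₁, hk h₂⟩
  have hSK : closure S ⊆ K ×ˢ K := fun x hx => by
    obtain ⟨k, hk⟩ := mem_iUnion.1 (hSA hx)
    exact ⟨hk.1.1, hk.2.1⟩
  have hSP : MapsTo (Prod.map P P) (closure S) (closure S) := by
    refine MapsTo.closure ?_ (hP.prodMap hP)
    rintro x ⟨C, hCK, hC, h₁, h₂⟩
    exact ⟨P '' C, (hPK.mono_left hCK).image_subset, hC.image P hP.continuousOn,
      mem_image_of_mem P h₁, mem_image_of_mem P h₂⟩
  have hScomp : IsCompact (closure S) := (hK.prod hK).of_isClosed_subset isClosed_closure hSK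
  have hδ : ContinuousOn (fun x : ℂ × ℂ => halfPlaneDist (σ x.1) (σ x.2)) (closure S) := by
    have h₁ : ContinuousOn (fun x : ℂ × ℂ => σ x.1) (closure S) :=
      hσc.comp continuousOn_fst fun x hx => (hSK hx).1
    have h₂ : ContinuousOn (fun x : ℂ × ℂ => σ x.2) (closure S) :=
      hσc.comp continuousOn_snd fun x hx => (hSK hx).2
    exact ((h₁.sub h₂).div (h₁.add (continuous_conj.comp_continuousOn h₂)) fun x hx =>
      add_conj_ne_zero (hσpos _ (hSK hx).1) (hσpos _ (hSK hx).2)).norm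
  intro C hCK hC a ha b hb
  have hab : (a, b) ∈ closure S := subset_closure ⟨C, hCK, hC, ha, hb⟩
  obtain ⟨⟨x, y⟩, hxy, hmax⟩ := hScomp.exists_isMaxOn ⟨_, hab⟩ hδ
  have hxyeq : x = y := by
    by_contra hne
    obtain ⟨k, hx, hy⟩ : ∃ k, x ∈ A k ∧ y ∈ A k := by
      simpa only [mem_iUnion, prodMk_mem_set_prod_eq] using hSA hxy
    have hPx := hσpos _ (hPK hx.1)
    have hPy := hσpos _ (hPK hy.1)
    have hlt := halfPlaneDist_map_lt (h := fun v => σ (g k v))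
      (differentiableOn_sqrt.comp ((hgd k).add_const ε) (hgε k))
      (fun v hv => re_sqrt_pos (hgε k v hv)) hp (hmiss k) hPx hPy fun h => hne <| by
        rw [← hx.2, ← hy.2, h]
    simp only [hx.2, hy.2] at hlt
    have hge : halfPlaneDist (σ (P x)) (σ (P y)) ≤ halfPlaneDist (σ x) (σ y) :=
      isMaxOn_iff.1 hmax (P x, P y) (hSP hxy)
    exact hlt.not_ge hge
  have hle : halfPlaneDist (σ a) (σ b) ≤ halfPlaneDist (σ x) (σ y) :=
    isMaxOn_iff.1 hmax (a, b) hab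
  have h0 : halfPlaneDist (σ x) (σ y) = 0 := by simp [hxyeq, halfPlaneDist]
  exact hσinj _ _ (eq_of_halfPlaneDist_eq_zero (hσpos _ (hCK ha)) (hσpos _ (hCK hb))
    ((hle.trans_eq h0).antisymm (halfPlaneDist_nonneg _ _)))

/-- A cubic with two distinct real critical points and negative sum of critical points is affinely
equivalent to the Chebyshev polynomial `4 y ^ 3 - 3 y`. The point `x₀` is the critical point with
the larger critical value. -/
theorem exists_cubic_eq_chebyshev {a b c : ℝ} (hb : 0 < b) (hc : 0 < c) (hlow : 3 * a * c < b ^ 2) :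
    ∃ m β α x₀ : ℝ, β ≠ 0 ∧ 0 < α ∧ x₀ < 0 ∧ ∀ y : ℂ,
      a * (m + β * y) + b * (m + β * y) ^ 2 + c * (m + β * y) ^ 3 =
        α * (4 * y ^ 3 - 3 * y) - α + (a * x₀ + b * x₀ ^ 2 + c * x₀ ^ 3 : ℝ) := by
  obtain ⟨m, hm⟩ : ∃ m : ℝ, b = -3 * c * m := ⟨-b / (3 * c), by field_simp⟩
  have hpos : 0 < 4 * (b ^ 2 - 3 * a * c) / (9 * c ^ 2) := by
    have := sub_pos.2 hlow
    positivity
  set β := √(4 * (b ^ 2 - 3 * a * c) / (9 * c ^ 2)) with hβ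
  have hβpos : 0 < β := Real.sqrt_pos.2 hpos
  have hβsq : β ^ 2 = 4 * (b ^ 2 - 3 * a * c) / (9 * c ^ 2) := Real.sq_sqrt hpos.le
  have ha : a = 3 * c * m ^ 2 - 3 * c * β ^ 2 / 4 := by
    rw [hβsq, hm]
    field_simp
    ring
  have hmneg : m < 0 := by nlinarith
  refine ⟨m, β, c * β ^ 3 / 4, m - β / 2, hβpos.ne', by positivity, by linarith, fun y => ?_⟩
  clear_value β
  rw [ha, hm]
  push_cast
  ring

theorem exists_cubic_branches {a b c : ℝ} (hb : 0 < b) (hc : 0 < c) (hlow : 3 * a * c < b ^ 2)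
    (hneg : ∀ x < 0, a * x + b * x ^ 2 + c * x ^ 3 < 0) :
    ∃ e : ℝ, 0 < e ∧ ∃ g : Fin 3 → ℂ → ℂ, (∀ k, DifferentiableOn ℂ (g k) {v | 0 < v.re}) ∧
      ∀ v : ℂ, 0 < v.re →
        (∀ z, a * z + b * z ^ 2 + c * z ^ 3 = v ^ 2 - e ↔ ∃ k, z = g k v) ∧
          Function.Injective fun k => g k v := by
  obtain ⟨m, β, α, x₀, hβ, hα, hx₀, hcheb⟩ := exists_cubic_eq_chebyshev hb hc hlow
  obtain ⟨Y, hYd, hY⟩ := exists_chebyshev_branches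
  obtain ⟨e, he⟩ : ∃ e : ℝ, a * x₀ + b * x₀ ^ 2 + c * x₀ ^ 3 = -2 * e :=
    ⟨-(a * x₀ + b * x₀ ^ 2 + c * x₀ ^ 3) / 2, by ring⟩
  have hepos : 0 < e := by linarith [hneg x₀ hx₀]
  rw [he] at hcheb
  have hβ' : (β : ℂ) ≠ 0 := ofReal_ne_zero.2 hβ
  have hα' : (α : ℂ) ≠ 0 := ofReal_ne_zero.2 hα.ne'
  have hslit : ∀ v : ℂ, 0 < v.re → (v ^ 2 + e) / (2 * α : ℝ) ∈ slitPlane := fun v hv => by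
    rw [mem_slitPlane_iff, div_ofReal_re, div_ofReal_im, add_re, add_im, ofReal_re, ofReal_im,
      add_zero]
    rcases sq_mem_slitPlane hv with h | h
    · left; positivity
    · right; exact div_ne_zero h (by positivity)
  refine ⟨e, hepos, fun k v => m + β * Y k ((v ^ 2 + e) / (2 * α : ℝ)), fun k => ?_, fun v hv => ?_⟩
  · exact (((hYd k).comp (by fun_prop) hslit).const_mul _).const_add _
  obtain ⟨h₁, h₂⟩ := hY _ (hslit v hv)
  refine ⟨fun z => ?_, fun i j hij => h₂ ?_⟩
  · obtain ⟨y, rfl⟩ : ∃ y, z = m + β * y := ⟨(z - m) / β, by field_simp; ring⟩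
    have hiff : a * (m + β * y) + b * (m + β * y) ^ 2 + c * (m + β * y) ^ 3 = v ^ 2 - e ↔
        4 * y ^ 3 - 3 * y = 2 * ((v ^ 2 + e) / (2 * α : ℝ)) + 1 := by
      rw [hcheb]
      push_cast
      constructor
      · intro h
        field_simp
        linear_combination h
      · intro h
        field_simp at h
        linear_combination h
    rw [hiff, h₁]
    simp [hβ]
  · simpa [hβ] using hij

/-- The filled-in Julia set of a real cubic whose critical points are negative reals, and which has
no negative fixed point, is compact and totally disconnected. -/
theorem isTotallyDisconnected_filledJulia_cubic {a b c : ℝ} (hb : 0 < b) (hc : 0 < c)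
    (hlow : 3 * a * c < b ^ 2) (hhigh : b ^ 2 < 4 * c * (a - 1)) {P : ℂ → ℂ}
    (hP : ∀ z, P z = a * z + b * z ^ 2 + c * z ^ 3) :
    IsCompact {z : ℂ | Bornology.IsBounded (range fun n => P^[n] z)} ∧
      IsTotallyDisconnected {z : ℂ | Bornology.IsBounded (range fun n => P^[n] z)} := by
  have hPc : Continuous P := by
    rw [funext hP]
    fun_prop
  have ha : 1 < a := by nlinarith [sq_nonneg b]
  set K := {z : ℂ | Bornology.IsBounded (range fun n => P^[n] z)}
  have hmemK : ∀ z, z ∈ K ↔ Bornology.IsBounded (range fun n => P^[n] z) := fun z => Iff.rfl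
  obtain ⟨l, hl, hlP⟩ : ∃ l : ℝ, 1 < l ∧ ∀ x < 0, a * x + b * x ^ 2 + c * x ^ 3 ≤ l * x := by
    refine ⟨a - b ^ 2 / (4 * c), ?_, fun x hx => ?_⟩
    · rw [lt_sub_comm, div_lt_iff₀ (by positivity)]
      linarith
    · have h : a * x + b * x ^ 2 + c * x ^ 3 - (a - b ^ 2 / (4 * c)) * x =
          x * (c * (x + b / (2 * c)) ^ 2) := by
        field_simp
        ring
      have : x * (c * (x + b / (2 * c)) ^ 2) ≤ 0 :=
        mul_nonpos_of_nonpos_of_nonneg hx.le (by positivity)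
      linarith
  have hPreal : ∀ x : ℝ, P x = (a * x + b * x ^ 2 + c * x ^ 3 : ℝ) := fun x => by
    rw [hP]
    push_cast
    ring
  have hK : IsCompact K := by
    have hR : 0 < (a + b + 2) / c + 1 := by positivity
    refine isCompact_setOf_isBounded_orbit hPc hR fun z hz => ?_
    have h₁ : 1 ≤ ‖z‖ := le_trans (by linarith [show 0 < (a + b + 2) / c by positivity]) hz
    have h₂ : a + b + 2 ≤ c * ‖z‖ := by
      rw [← div_le_iff₀' hc]
      linarith
    have h₃ : ‖(c : ℂ) * z ^ 3‖ ≤ ‖P z‖ + ‖(a : ℂ) * z‖ + ‖(b : ℂ) * z ^ 2‖ := by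
      rw [show (c : ℂ) * z ^ 3 = P z - a * z - b * z ^ 2 by rw [hP]; ring]
      exact (norm_sub_le _ _).trans (by gcongr; exact norm_sub_le _ _)
    simp only [norm_mul, norm_pow, norm_real, Real.norm_eq_abs, abs_of_pos hb, abs_of_pos hc,
      abs_of_pos (zero_lt_one.trans ha)] at h₃
    have h₄ : 0 ≤ ‖z‖ ^ 2 * (c * ‖z‖ - (a + b + 2)) :=
      mul_nonneg (by positivity) (sub_nonneg.2 h₂)
    have h₅ : 0 ≤ (a + 2) * ‖z‖ * (‖z‖ - 1) :=
      mul_nonneg (by positivity) (sub_nonneg.2 h₁)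
    nlinarith
  refine ⟨hK, ?_⟩
  have hPK : MapsTo P K K := fun z hz => by
    refine (hmemK _).2 (((hmemK z).1 hz).subset ?_)
    rintro _ ⟨n, rfl⟩
    exact ⟨n + 1, Function.iterate_succ_apply P n z⟩
  have hescape : ∀ x : ℝ, x < 0 → (x : ℂ) ∉ K := fun x hx hxK => by
    have hiter : ∀ n : ℕ, ∃ y : ℝ, P^[n] x = y ∧ y ≤ l ^ n * x := by
      intro n
      induction n with
      | zero => exact ⟨x, by simp⟩
      | succ n ih =>
        obtain ⟨y, hy, hyl⟩ := ih
        have hy0 : y < 0 := hyl.trans_lt (mul_neg_of_pos_of_neg (by positivity) hx)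
        refine ⟨_, by rw [Function.iterate_succ_apply', hy, hPreal], (hlP y hy0).trans ?_⟩
        rw [pow_succ', mul_assoc]
        exact mul_le_mul_of_nonneg_left hyl (by positivity)
    obtain ⟨M, hM⟩ := isBounded_iff_forall_norm_le.1 ((hmemK _).1 hxK)
    obtain ⟨n, hn⟩ := pow_unbounded_of_one_lt (M / -x) hl
    obtain ⟨y, hy, hyl⟩ := hiter n
    have h₁ : ‖P^[n] x‖ ≤ M := hM _ (mem_range_self n)
    rw [hy, norm_real, Real.norm_eq_abs] at h₁
    rw [div_lt_iff₀ (neg_pos.2 hx)] at hn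
    linarith [neg_abs_le y]
  obtain ⟨e, he, g, hgd, hg⟩ := exists_cubic_branches hb hc hlow fun x hx =>
    (hlP x hx).trans_lt (mul_neg_of_pos_of_neg (by positivity) hx)
  have hbranch : ∀ k, ∀ v : ℂ, 0 < v.re → P (g k v) = v ^ 2 - e := fun k v hv => by
    rw [hP]
    exact ((hg v hv).1 _).2 ⟨k, rfl⟩
  have hreal : ∀ z : ℂ, z + e ∉ slitPlane → ∃ x : ℝ, z = x ∧ x ≤ -e := fun z hz => by
    rw [mem_slitPlane_iff, not_or, not_lt, not_not, add_re, add_im, ofReal_re, ofReal_im,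
      add_zero] at hz
    exact ⟨z.re, Complex.ext (by simp) (by simp [hz.2]), by linarith⟩
  have hfar : ∀ k, ∀ v : ℂ, 0 < v.re → ∀ x : ℝ, x ≤ -e / l → g k v ≠ x := fun k v hv x hx h => by
    have hx0 : x < 0 := hx.trans_lt (div_neg_of_neg_of_pos (neg_lt_zero.2 he) (by positivity))
    rw [le_div_iff₀ (by positivity)] at hx
    have h₁ := hbranch k v hv
    rw [h, hPreal] at h₁
    have h₂ : v ^ 2 = ((a * x + b * x ^ 2 + c * x ^ 3 + e : ℝ) : ℂ) := by
      rw [ofReal_add, h₁]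
      ring
    have h₃ := sq_mem_slitPlane hv
    rw [h₂, ofReal_mem_slitPlane] at h₃
    linarith [hlP x hx0]
  have hel : e / l < e := div_lt_self he hl
  refine isTotallyDisconnected_of_inverse_branches (p := (√(e - e / l) : ℝ)) hPc hK hPK
    (ε := (e : ℂ)) (fun z hz => ?_) hgd (fun v hv z => by rw [hP]; exact (hg v hv).1 z)
    (fun v hv => (hg v hv).2) (fun k v hv => ?_) ?_ fun k v hv h => ?_
  · by_contra hn
    obtain ⟨x, rfl, hx⟩ := hreal z hn
    exact hescape x (by linarith) hz
  · by_contra hn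
    obtain ⟨x, hx, hxe⟩ := hreal _ hn
    refine hfar k v hv x (hxe.trans ?_) hx
    rw [neg_div]
    linarith
  · rw [ofReal_re]
    exact Real.sqrt_pos.2 (by linarith)
  · have h₁ := congrArg (· ^ 2) h
    simp only [sqrt_sq_self] at h₁
    rw [← ofReal_pow, Real.sq_sqrt (by linarith)] at h₁
    refine hfar k v hv (-e / l) le_rfl ?_
    push_cast at h₁ ⊢
    linear_combination h₁

/-- For a finite simple graph with independence number 3 whose reduced
independence polynomial is `P(z) = a₁z + a₂z² + a₃z³`, if `3·a₁·a₃ < a₂² < 4·a₃·(a₁ − 1)`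
then the Julia set of `P` is totally disconnected. -/
theorem stmt_3 {V : Type*} [Fintype V] [DecidableEq V]
    (G : SimpleGraph V) [DecidableRel G.Adj]
    (a₁ a₂ a₃ : ℕ)
    (ha₁ : a₁ = Fintype.card V)
    (ha₂ : a₂ = (Finset.univ.filter
      (fun s : Finset V => s.card = 2 ∧ ∀ u ∈ s, ∀ v ∈ s, ¬ G.Adj u v)).card)
    (ha₃ : a₃ = (Finset.univ.filter
      (fun s : Finset V => s.card = 3 ∧ ∀ u ∈ s, ∀ v ∈ s, ¬ G.Adj u v)).card)
    (hindep3 : ∃ s : Finset V, s.card = 3 ∧ ∀ u ∈ s, ∀ v ∈ s, ¬ G.Adj u v)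
    (hindep4 : ¬ ∃ s : Finset V, s.card = 4 ∧ ∀ u ∈ s, ∀ v ∈ s, ¬ G.Adj u v)
    (P : ℂ → ℂ)
    (hP : ∀ z, P z = a₁ * z + a₂ * z ^ 2 + a₃ * z ^ 3)
    (hlow : (3 * a₁ * a₃ : ℤ) < (a₂ : ℤ) ^ 2)
    (hhigh : (a₂ : ℤ) ^ 2 < 4 * a₃ * ((a₁ : ℤ) - 1)) :
    IsTotallyDisconnected
      (frontier {z : ℂ | Bornology.IsBounded (Set.range fun n => P^[n] z)}) := by
  have h₂ : 0 < a₂ := Nat.pos_of_ne_zero fun h => by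
    simp only [h, Nat.cast_zero, ne_eq, OfNat.ofNat_ne_zero, not_false_eq_true, zero_pow] at hlow
    exact absurd hlow (not_lt.2 (by positivity))
  have h₃ : 0 < a₃ := Nat.pos_of_ne_zero fun h => by
    simp only [h, Nat.cast_zero, mul_zero, zero_mul] at hhigh
    exact absurd hhigh (not_lt.2 (by positivity))
  obtain ⟨hcomp, hdisc⟩ := isTotallyDisconnected_filledJulia_cubic (a := a₁) (b := a₂) (c := a₃)
    (Nat.cast_pos.2 h₂) (Nat.cast_pos.2 h₃) (by exact_mod_cast hlow) (by exact_mod_cast hhigh)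
    (P := P) (fun z => by rw [hP]; push_cast; rfl)
  exact fun t ht => hdisc t (ht.trans hcomp.isClosed.frontier_subset)
end
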